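/- arXiv:1405.6813 — 3 statements merged into one kernel-verified Lean document; each statement's English description precedes it below -/
import Mathlib

section
/- Let T < ∞ and let u, v : ℝⁿ × [0,T] → ℝ be smooth solutions of the biharmonic heat equation ∂ₜu = -Δ²u, ∂ₜv = -Δ²v, which satisfy |Δv|²(x,t) + |Δu|²(x,t) ≤ k₀/t for some k₀ ∈ ℝ, for all t ∈ (0,T] and all x ∈ ℝⁿ, and which have the same initial value: u(·,0) = v(·,0). Then u ≡ v on ℝⁿ × [0,T]. -/
open MeasureTheory Metric Set

noncomputable section

/-- The spatial Laplacian of a function `f : ℝⁿ → ℝ`: `Δf(x) = ∑ i, ∂²f/∂xᵢ²(x)`. -/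
def Lap {n : ℕ} (f : EuclideanSpace ℝ (Fin n) → ℝ) : EuclideanSpace ℝ (Fin n) → ℝ :=
  fun x => ∑ i : Fin n,
    iteratedFDeriv ℝ 2 f x (fun _ => EuclideanSpace.single i (1 : ℝ))

/-- The `k`-th iterated Laplacian (`iterLap 0 f = f`, `iterLap 2 f = Δ²f`). -/
def iterLap {n : ℕ} (k : ℕ) (f : EuclideanSpace ℝ (Fin n) → ℝ) :
    EuclideanSpace ℝ (Fin n) → ℝ :=
  Lap^[k] f

/-- The partial derivative of `f` in the `i`-th coordinate direction. -/
def pd {n : ℕ} (i : Fin n) (f : EuclideanSpace ℝ (Fin n) → ℝ) : EuclideanSpace ℝ (Fin n) → ℝ :=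
  fun x => fderiv ℝ f x (EuclideanSpace.single i (1 : ℝ))

section Spatial

variable {n : ℕ} {f g : EuclideanSpace ℝ (Fin n) → ℝ}

theorem ContDiff.pd {m k : WithTop ℕ∞} (hf : ContDiff ℝ k f) (hmk : m + 1 ≤ k) (i : Fin n) :
    ContDiff ℝ m (pd i f) :=
  (hf.fderiv_right hmk).clm_apply contDiff_const

theorem lap_eq_sum_pd (hf : ContDiff ℝ 2 f) (x : EuclideanSpace ℝ (Fin n)) :
    Lap f x = ∑ i, pd i (pd i f) x := by
  refine Finset.sum_congr rfl fun i _ => ?_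
  have h : DifferentiableAt ℝ (fderiv ℝ f) x :=
    ((hf.fderiv_right (m := 1) (by norm_num)).differentiable (by norm_num)) x
  rw [iteratedFDeriv_two_apply]
  unfold _root_.pd
  rw [fderiv_clm_apply h (differentiableAt_const _)]
  simp

theorem ContDiff.lap {m k : WithTop ℕ∞} (hf : ContDiff ℝ k f) (hmk : m + 2 ≤ k) :
    ContDiff ℝ m (Lap f) := by
  have h : Lap f = fun x => ∑ i, _root_.pd i (_root_.pd i f) x :=
    funext (lap_eq_sum_pd (hf.of_le (le_add_self.trans hmk)))
  rw [h]
  exact ContDiff.sum fun i _ =>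
    (hf.pd (m := m + 1) (by rwa [add_assoc, one_add_one_eq_two]) i).pd le_rfl i

theorem pd_mul (hf : Differentiable ℝ f) (hg : Differentiable ℝ g) (i : Fin n) :
    pd i (fun x => f x * g x) = fun x => f x * pd i g x + g x * pd i f x := by
  ext x
  simp [pd, fderiv_fun_mul (hf x) (hg x)]

theorem pd_add (hf : Differentiable ℝ f) (hg : Differentiable ℝ g) (i : Fin n) :
    pd i (fun x => f x + g x) = fun x => pd i f x + pd i g x := by
  ext x
  simp [pd, fderiv_fun_add (hf x) (hg x)]

theorem pd_pd_mul (hf : ContDiff ℝ 2 f) (hg : ContDiff ℝ 2 g) (i : Fin n)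
    (x : EuclideanSpace ℝ (Fin n)) :
    pd i (pd i (fun x => f x * g x)) x =
      f x * pd i (pd i g) x + 2 * (pd i f x * pd i g x) + g x * pd i (pd i f) x := by
  have hf1 := hf.differentiable (by norm_num)
  have hg1 := hg.differentiable (by norm_num)
  have hf2 := (hf.pd (m := 1) (by norm_num) i).differentiable (by norm_num)
  have hg2 := (hg.pd (m := 1) (by norm_num) i).differentiable (by norm_num)
  rw [pd_mul hf1 hg1, pd_add (f := fun x => f x * pd i g x) (g := fun x => g x * pd i f x)
    (hf1.mul hg2) (hg1.mul hf2), pd_mul hf1 hg2, pd_mul hg1 hf2]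
  ring

theorem lap_mul (hf : ContDiff ℝ 2 f) (hg : ContDiff ℝ 2 g) (x : EuclideanSpace ℝ (Fin n)) :
    Lap (fun x => f x * g x) x =
      f x * Lap g x + 2 * ∑ i, pd i f x * pd i g x + g x * Lap f x := by
  rw [lap_eq_sum_pd (hf.mul hg), lap_eq_sum_pd hf, lap_eq_sum_pd hg]
  simp only [pd_pd_mul hf hg, Finset.sum_add_distrib, Finset.mul_sum]

theorem lap_sub (hf : ContDiff ℝ 2 f) (hg : ContDiff ℝ 2 g) (x : EuclideanSpace ℝ (Fin n)) :
    Lap (fun x => f x - g x) x = Lap f x - Lap g x := by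
  have h := iteratedFDeriv_sub_apply (i := 2) (x := x) (hf.contDiffAt) (hg.contDiffAt)
  have h' : iteratedFDeriv ℝ 2 (fun x => f x - g x) x =
    iteratedFDeriv ℝ 2 f x - iteratedFDeriv ℝ 2 g x := h
  simp [Lap, h', Finset.sum_sub_distrib]

theorem integral_mul_pd (hf : ContDiff ℝ 1 f) (hg : ContDiff ℝ 1 g) (hs : HasCompactSupport f)
    (i : Fin n) : ∫ x, f x * pd i g x = - ∫ x, pd i f x * g x := by
  have hf' := (hf.pd (m := 0) (by norm_num) i).continuous
  have hg' := (hg.pd (m := 0) (by norm_num) i).continuous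
  refine integral_mul_fderiv_eq_neg_fderiv_mul_of_integrable ?_ ?_ ?_
    (fun x _ => hf.differentiable (by norm_num) x) (fun x _ => hg.differentiable (by norm_num) x)
  · exact (hf'.mul hg.continuous).integrable_of_hasCompactSupport (hs.fderiv_apply ℝ _).mul_right
  · exact (hf.continuous.mul hg').integrable_of_hasCompactSupport hs.mul_right
  · exact (hf.continuous.mul hg.continuous).integrable_of_hasCompactSupport hs.mul_right

theorem HasCompactSupport.pd (hs : HasCompactSupport f) (i : Fin n) :
    HasCompactSupport (pd i f) := hs.fderiv_apply ℝ _

theorem integral_mul_pd_pd (hf : ContDiff ℝ 2 f) (hg : ContDiff ℝ 2 g)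
    (hs : HasCompactSupport f) (i : Fin n) :
    ∫ x, f x * pd i (pd i g) x = ∫ x, pd i (pd i f) x * g x := by
  rw [integral_mul_pd (hf.of_le (by norm_num)) (hg.pd (by norm_num) i) hs,
    integral_mul_pd (hf.pd (by norm_num) i) (hg.of_le (by norm_num)) (hs.pd i), neg_neg]

theorem integral_mul_lap (hf : ContDiff ℝ 2 f) (hg : ContDiff ℝ 2 g)
    (hs : HasCompactSupport f) :
    ∫ x, f x * Lap g x = ∫ x, Lap f x * g x := by
  simp only [lap_eq_sum_pd hf, lap_eq_sum_pd hg, Finset.mul_sum, Finset.sum_mul]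
  have hf' := fun i => ((hf.pd (m := 1) (by norm_num) i).pd (m := 0) (by norm_num) i).continuous
  have hg' := fun i => ((hg.pd (m := 1) (by norm_num) i).pd (m := 0) (by norm_num) i).continuous
  rw [integral_finsetSum, integral_finsetSum]
  · exact Finset.sum_congr rfl fun i _ => integral_mul_pd_pd hf hg hs i
  · exact fun i _ => ((hf' i).mul hg.continuous).integrable_of_hasCompactSupport
      ((hs.pd i).pd i).mul_right
  · exact fun i _ => (hf.continuous.mul (hg' i)).integrable_of_hasCompactSupport hs.mul_right

end Spatial

section ParametricIntegral

variable {n : ℕ}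

theorem hasFDerivAt_intervalIntegral_of_contDiff {H F : Type} [NormedAddCommGroup H]
    [NormedSpace ℝ H] [ProperSpace H] [NormedAddCommGroup F] [NormedSpace ℝ F] [CompleteSpace F]
    {G : H × ℝ → F} (hG : ContDiff ℝ 1 G) (s : ℝ) (x : H) :
    HasFDerivAt (fun y => ∫ σ in (0 : ℝ)..s, G (y, σ))
      (∫ σ in (0 : ℝ)..s, (fderiv ℝ G (x, σ)).comp (ContinuousLinearMap.inl ℝ H ℝ)) x := by
  have hc : Continuous fun p : H × ℝ =>
      (fderiv ℝ G p).comp (ContinuousLinearMap.inl ℝ H ℝ) :=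
    (hG.continuous_fderiv (by norm_num)).clm_comp continuous_const
  obtain ⟨C, hC⟩ := ((isCompact_closedBall x 1).prod (isCompact_uIcc (a := (0 : ℝ)) (b := s))
    ).exists_bound_of_continuousOn hc.continuousOn
  refine intervalIntegral.hasFDerivAt_integral_of_dominated_of_fderiv_le
    (F := fun y σ => G (y, σ))
    (F' := fun y σ => (fderiv ℝ G (y, σ)).comp (ContinuousLinearMap.inl ℝ H ℝ))
    (bound := fun _ => C) (closedBall_mem_nhds x one_pos) ?_ ?_ ?_ ?_ ?_ ?_
  · exact .of_forall fun y =>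
      (hG.continuous.comp (Continuous.prodMk_right y)).aestronglyMeasurable
  · exact (hG.continuous.comp (Continuous.prodMk_right x)).intervalIntegrable _ _
  · exact (hc.comp (Continuous.prodMk_right x)).aestronglyMeasurable
  · exact .of_forall fun σ hσ y hy => hC (y, σ) ⟨hy, uIoc_subset_uIcc hσ⟩
  · exact intervalIntegrable_const
  · refine .of_forall fun σ hσ y hy => ?_
    exact ((hG.differentiable (by norm_num) (y, σ)).hasFDerivAt).comp y
      (hasFDerivAt_prodMk_left y σ)

/-- The spatial partial derivative of a function of space and time. -/
def spd (i : Fin n) (G : EuclideanSpace ℝ (Fin n) × ℝ → ℝ) : EuclideanSpace ℝ (Fin n) × ℝ → ℝ :=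
  fun p => fderiv ℝ G p (EuclideanSpace.single i (1 : ℝ), 0)

/-- The spatial Laplacian of a function of space and time. -/
def spaceLap (G : EuclideanSpace ℝ (Fin n) × ℝ → ℝ) : EuclideanSpace ℝ (Fin n) × ℝ → ℝ :=
  fun p => ∑ i, spd i (spd i G) p

variable {G : EuclideanSpace ℝ (Fin n) × ℝ → ℝ}

theorem ContDiff.spd {m k : WithTop ℕ∞} (hG : ContDiff ℝ k G) (hmk : m + 1 ≤ k) (i : Fin n) :
    ContDiff ℝ m (spd i G) :=
  (hG.fderiv_right hmk).clm_apply contDiff_const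

theorem ContDiff.spaceLap {m k : WithTop ℕ∞} (hG : ContDiff ℝ k G) (hmk : m + 2 ≤ k) :
    ContDiff ℝ m (spaceLap G) :=
  ContDiff.sum fun i _ =>
    (hG.spd (m := m + 1) (by rwa [add_assoc, one_add_one_eq_two]) i).spd le_rfl i

theorem contDiff_slice {k : WithTop ℕ∞} (hG : ContDiff ℝ k G) (s : ℝ) :
    ContDiff ℝ k fun y => G (y, s) :=
  hG.comp (contDiff_prodMk_left s)

theorem pd_slice (hG : ContDiff ℝ 1 G) (i : Fin n) (s : ℝ) :
    pd i (fun y => G (y, s)) = fun y => spd i G (y, s) := by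
  ext y
  have h := HasFDerivAt.comp (f := fun e => (e, s)) y
    (hG.differentiable (by norm_num) (y, s)).hasFDerivAt (hasFDerivAt_prodMk_left y s)
  have h' : fderiv ℝ (fun y => G (y, s)) y = _ := h.fderiv
  simp [pd, spd, h']

theorem lap_slice (hG : ContDiff ℝ 2 G) (s : ℝ) (x : EuclideanSpace ℝ (Fin n)) :
    Lap (fun y => G (y, s)) x = spaceLap G (x, s) := by
  rw [lap_eq_sum_pd (contDiff_slice hG s)]
  refine Finset.sum_congr rfl fun i _ => ?_
  rw [pd_slice (hG.of_le (by norm_num)), pd_slice (hG.spd (by norm_num) i)]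

theorem fderiv_intervalIntegral_apply (hG : ContDiff ℝ 1 G) (s : ℝ)
    (y v : EuclideanSpace ℝ (Fin n)) :
    fderiv ℝ (fun y => ∫ σ in (0 : ℝ)..s, G (y, σ)) y v =
      ∫ σ in (0 : ℝ)..s, fderiv ℝ G (y, σ) (v, 0) := by
  have hc : Continuous fun p : EuclideanSpace ℝ (Fin n) × ℝ =>
      (fderiv ℝ G p).comp (ContinuousLinearMap.inl ℝ (EuclideanSpace ℝ (Fin n)) ℝ) :=
    (hG.continuous_fderiv (by norm_num)).clm_comp continuous_const
  have hi : IntervalIntegrable (fun σ => (fderiv ℝ G (y, σ)).comp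
      (ContinuousLinearMap.inl ℝ (EuclideanSpace ℝ (Fin n)) ℝ)) volume 0 s :=
    (hc.comp (Continuous.prodMk_right y)).intervalIntegrable _ _
  rw [(hasFDerivAt_intervalIntegral_of_contDiff hG s y).fderiv,
    ContinuousLinearMap.intervalIntegral_apply hi]
  simp

theorem pd_intervalIntegral (hG : ContDiff ℝ 1 G) (i : Fin n) (s : ℝ) :
    pd i (fun y => ∫ σ in (0 : ℝ)..s, G (y, σ)) =
      fun y => ∫ σ in (0 : ℝ)..s, spd i G (y, σ) :=
  funext fun y => fderiv_intervalIntegral_apply hG s y _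

theorem continuous_intervalIntegral_slice (hG : Continuous G) (s : ℝ) :
    Continuous fun y => ∫ σ in (0 : ℝ)..s, G (y, σ) :=
  intervalIntegral.continuous_parametric_intervalIntegral_of_continuous'
    (f := fun y σ => G (y, σ)) hG 0 s

theorem contDiff_intervalIntegral_slice (k : ℕ) (hG : ContDiff ℝ k G) (s : ℝ) :
    ContDiff ℝ k fun y => ∫ σ in (0 : ℝ)..s, G (y, σ) := by
  induction k generalizing G with
  | zero =>
    rw [Nat.cast_zero, contDiff_zero] at hG ⊢
    exact continuous_intervalIntegral_slice hG s
  | succ k ih =>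
    have hG1 : ContDiff ℝ 1 G := hG.of_le (by norm_cast; omega)
    rw [Nat.cast_add, Nat.cast_one, contDiff_succ_iff_fderiv_apply]
    refine ⟨fun y => (hasFDerivAt_intervalIntegral_of_contDiff hG1 s y).differentiableAt,
      by simp, fun v => ?_⟩
    simp only [fderiv_intervalIntegral_apply hG1]
    refine ih ((hG.fderiv_right (m := k) ?_).clm_apply contDiff_const)
    norm_cast

theorem lap_intervalIntegral (hG : ContDiff ℝ 2 G) (s : ℝ) (x : EuclideanSpace ℝ (Fin n)) :
    Lap (fun y => ∫ σ in (0 : ℝ)..s, G (y, σ)) x = ∫ σ in (0 : ℝ)..s, spaceLap G (x, σ) := by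
  rw [lap_eq_sum_pd (contDiff_intervalIntegral_slice 2 hG s)]
  unfold spaceLap
  rw [intervalIntegral.integral_finsetSum]
  · refine Finset.sum_congr rfl fun i _ => ?_
    rw [pd_intervalIntegral (hG.of_le (by norm_num)), pd_intervalIntegral (hG.spd (by norm_num) i)]
  · intro i _
    have h := ((hG.spd (m := 1) (by norm_num) i).spd (m := 0) (by norm_num) i).continuous
    exact (h.comp (Continuous.prodMk_right x)).intervalIntegrable _ _

end ParametricIntegral

section Energy

theorem energy_density_le {g w f l G p q a : ℝ} (hg0 : 0 ≤ g) (hg1 : g ≤ 1) (hG0 : 0 ≤ G)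
    (hG : G ≤ a) (hl : |l| ≤ a) (hq : 0 ≤ q) (hp : p ^ 2 ≤ G * q) :
    2 * ((g ^ 4 * (-w) + 8 * g ^ 3 * p + f * (4 * g ^ 3 * l + 12 * g ^ 2 * G)) * w) +
      64 * a * ((2 * g * l + 2 * G) * f ^ 2 - g ^ 2 * (2 * q - 2 * f * w)) ≤
      8960 * a ^ 2 * f ^ 2 := by
  have ha : 0 ≤ a := hG0.trans hG
  have hgl : |g * l| ≤ a := by
    rw [abs_mul, abs_of_nonneg hg0]
    calc g * |l| ≤ 1 * a := mul_le_mul hg1 hl (abs_nonneg l) zero_le_one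
      _ = a := one_mul a
  obtain ⟨h1, h2⟩ := abs_le.1 hgl
  have e1 : 16 * w * g ^ 3 * p ≤ 1 / 2 * g ^ 4 * w ^ 2 + 128 * a * g ^ 2 * q := by
    have h3 : p ^ 2 ≤ a * q := hp.trans (mul_le_mul_of_nonneg_right hG hq)
    have h4 : g ^ 2 * p ^ 2 ≤ g ^ 2 * (a * q) := mul_le_mul_of_nonneg_left h3 (sq_nonneg g)
    nlinarith [sq_nonneg (g ^ 2 * w - 16 * g * p)]
  have e2 : 128 * a * g ^ 2 * f * w ≤ 1 / 2 * g ^ 4 * w ^ 2 + 8192 * a ^ 2 * f ^ 2 := by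
    nlinarith [sq_nonneg (g ^ 2 * w - 128 * a * f)]
  have e3 : 2 * w * f * g ^ 2 * (4 * (g * l) + 12 * G) ≤
      1 / 2 * g ^ 4 * w ^ 2 + 512 * a ^ 2 * f ^ 2 := by
    have h3 : (4 * (g * l) + 12 * G) ^ 2 ≤ (16 * a) ^ 2 := by
      apply sq_le_sq'
      · linarith
      · linarith
    have h4 := mul_le_mul_of_nonneg_left h3 (sq_nonneg f)
    nlinarith [sq_nonneg (g ^ 2 * w - 2 * f * (4 * (g * l) + 12 * G))]
  have e4 : 64 * a * ((2 * (g * l) + 2 * G) * f ^ 2) ≤ 256 * a ^ 2 * f ^ 2 := by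
    have h3 : (2 * (g * l) + 2 * G) * f ^ 2 ≤ 4 * a * f ^ 2 :=
      mul_le_mul_of_nonneg_right (by linarith) (sq_nonneg f)
    nlinarith
  have e5 : 0 ≤ g ^ 4 * w ^ 2 := by positivity
  nlinarith

variable {n : ℕ} {f w g : EuclideanSpace ℝ (Fin n) → ℝ}

theorem integral_cutoff_mul_lap_le {a : ℝ} (hf : ContDiff ℝ 2 f) (hw : ContDiff ℝ 2 w)
    (hfw : ∀ x, Lap f x = - w x) (hg : ContDiff ℝ 2 g) (hs : HasCompactSupport g)
    (hg0 : ∀ x, 0 ≤ g x) (hg1 : ∀ x, g x ≤ 1) (hG : ∀ x, ∑ i, pd i g x ^ 2 ≤ a)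
    (hl : ∀ x, |Lap g x| ≤ a) :
    ∫ x, 2 * (g x ^ 4 * (f x * Lap w x)) ≤ 8960 * a ^ 2 * ∫ x in tsupport g, f x ^ 2 := by
  have hgd := hg.differentiable (by norm_num)
  have hpdg : ∀ i, Continuous (pd i g) := fun i => (hg.pd (m := 1) (by norm_num) i).continuous
  have hpdf : ∀ i, Continuous (pd i f) := fun i => (hf.pd (m := 1) (by norm_num) i).continuous
  have hLg := (hg.lap (m := 0) (by norm_num)).continuous
  have hgc := hg.continuous
  have hfc := hf.continuous
  have hwc := hw.continuous
  set k : EuclideanSpace ℝ (Fin n) → ℝ := fun x => g x * g x with hk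
  set h : EuclideanSpace ℝ (Fin n) → ℝ := fun x => k x * k x with hh
  have hk2 : ContDiff ℝ 2 k := hg.mul hg
  have hh2 : ContDiff ℝ 2 h := hk2.mul hk2
  have hpdk : ∀ i, pd i k = fun x => 2 * g x * pd i g x := fun i => by
    rw [hk, pd_mul hgd hgd]; ext x; ring
  have hpdh : ∀ i, pd i h = fun x => 4 * g x ^ 3 * pd i g x := fun i => by
    rw [hh, pd_mul (hk2.differentiable (by norm_num)) (hk2.differentiable (by norm_num)), hpdk]
    ext x; simp only [hk]; ring
  have hLk : ∀ x, Lap k x = 2 * g x * Lap g x + 2 * ∑ i, pd i g x ^ 2 := fun x => by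
    rw [hk, lap_mul hg hg]; simp only [← pow_two]; ring
  have hLh : ∀ x, Lap h x = 4 * g x ^ 3 * Lap g x + 12 * g x ^ 2 * ∑ i, pd i g x ^ 2 := fun x => by
    have e : ∑ i, pd i k x * pd i k x = 4 * g x ^ 2 * ∑ i, pd i g x ^ 2 := by
      simp only [hpdk, Finset.mul_sum]
      exact Finset.sum_congr rfl fun i _ => by ring
    rw [hh, lap_mul hk2 hk2, hLk, e]; simp only [hk]; ring
  have hLhf : ∀ x, Lap (fun x => h x * f x) x = g x ^ 4 * (-w x) +
      8 * g x ^ 3 * (∑ i, pd i g x * pd i f x) +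
      f x * (4 * g x ^ 3 * Lap g x + 12 * g x ^ 2 * ∑ i, pd i g x ^ 2) := fun x => by
    have e : ∑ i, pd i h x * pd i f x = 4 * g x ^ 3 * ∑ i, pd i g x * pd i f x := by
      simp only [hpdh, Finset.mul_sum]
      exact Finset.sum_congr rfl fun i _ => by ring
    rw [lap_mul hh2 hf, hLh, e, hfw]; simp only [hh, hk]; ring
  have hLff : ∀ x, Lap (fun x => f x * f x) x = 2 * (∑ i, pd i f x ^ 2) - 2 * f x * w x :=
    fun x => by rw [lap_mul hf hf, hfw]; simp only [← pow_two]; ring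
  have I1 := integral_mul_lap (hh2.mul hf) hw (hs.mul_right (f' := g)).mul_right.mul_right
  have I2 := integral_mul_lap hk2 (hf.mul hf) hs.mul_right
  simp only [hLhf] at I1
  simp only [hLk, hLff] at I2
  have hg_off : ∀ x ∉ tsupport g, g x = 0 := fun x hx => image_eq_zero_of_notMem_tsupport hx
  have hpdg_off : ∀ x ∉ tsupport g, ∀ i, pd i g x = 0 := fun x hx i => by
    simp [pd, fderiv_of_notMem_tsupport ℝ hx]
  have integrable_of : ∀ φ : EuclideanSpace ℝ (Fin n) → ℝ, Continuous φ →
      (∀ x ∉ tsupport g, φ x = 0) → Integrable φ := fun φ hφ h0 =>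
    hφ.integrable_of_hasCompactSupport (HasCompactSupport.intro hs h0)
  have iA : Integrable fun x => (g x ^ 4 * (-w x) + 8 * g x ^ 3 * (∑ i, pd i g x * pd i f x) +
      f x * (4 * g x ^ 3 * Lap g x + 12 * g x ^ 2 * ∑ i, pd i g x ^ 2)) * w x :=
    integrable_of _ (by fun_prop) fun x hx => by simp [hg_off x hx]
  have iB : Integrable fun x => (2 * g x * Lap g x + 2 * ∑ i, pd i g x ^ 2) * (f x * f x) :=
    integrable_of _ (by fun_prop) fun x hx => by simp [hg_off x hx, hpdg_off x hx]
  have iC : Integrable fun x => k x * (2 * (∑ i, pd i f x ^ 2) - 2 * f x * w x) :=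
    integrable_of _ (by fun_prop) fun x hx => by simp [hk, hg_off x hx]
  have iBC : Integrable fun x => 64 * a * ((2 * g x * Lap g x + 2 * ∑ i, pd i g x ^ 2) *
      (f x * f x) - k x * (2 * (∑ i, pd i f x ^ 2) - 2 * f x * w x)) :=
    (iB.sub iC).const_mul _
  calc ∫ x, 2 * (g x ^ 4 * (f x * Lap w x))
      = 2 * ∫ x, h x * f x * Lap w x := by
        rw [← integral_const_mul]
        exact integral_congr_ae (.of_forall fun x => by simp only [hh, hk]; ring)
    _ = ∫ x, (2 * ((g x ^ 4 * (-w x) + 8 * g x ^ 3 * (∑ i, pd i g x * pd i f x) +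
          f x * (4 * g x ^ 3 * Lap g x + 12 * g x ^ 2 * ∑ i, pd i g x ^ 2)) * w x) +
          64 * a * ((2 * g x * Lap g x + 2 * ∑ i, pd i g x ^ 2) * (f x * f x) -
          k x * (2 * (∑ i, pd i f x ^ 2) - 2 * f x * w x))) := by
        rw [integral_add (iA.const_mul 2) iBC, integral_const_mul,
          integral_const_mul, integral_sub iB iC, I1, I2, sub_self, mul_zero, add_zero]
    _ = ∫ x in tsupport g, (2 * ((g x ^ 4 * (-w x) + 8 * g x ^ 3 * (∑ i, pd i g x * pd i f x) +
          f x * (4 * g x ^ 3 * Lap g x + 12 * g x ^ 2 * ∑ i, pd i g x ^ 2)) * w x) +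
          64 * a * ((2 * g x * Lap g x + 2 * ∑ i, pd i g x ^ 2) * (f x * f x) -
          k x * (2 * (∑ i, pd i f x ^ 2) - 2 * f x * w x))) := by
        symm
        apply setIntegral_eq_integral_of_forall_compl_eq_zero
        intro x hx
        simp [hk, hg_off x hx, hpdg_off x hx]
    _ ≤ ∫ x in tsupport g, 8960 * a ^ 2 * f x ^ 2 := by
        refine integral_mono ((iA.const_mul 2).add iBC).integrableOn
          (ContinuousOn.integrableOn_compact hs (by fun_prop)) fun x => ?_
        have hp : (∑ i, pd i g x * pd i f x) ^ 2 ≤ (∑ i, pd i g x ^ 2) * ∑ i, pd i f x ^ 2 :=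
          Finset.sum_mul_sq_le_sq_mul_sq _ _ _
        have := energy_density_le (w := w x) (f := f x) (hg0 x) (hg1 x)
          (Finset.sum_nonneg fun i _ => sq_nonneg (pd i g x)) (hG x) (hl x)
          (Finset.sum_nonneg fun i _ => sq_nonneg (pd i f x)) hp
        simp only [hk]
        linarith
    _ = 8960 * a ^ 2 * ∫ x in tsupport g, f x ^ 2 := integral_const_mul _ _

end Energy

section Cutoff

variable {n : ℕ}

theorem pd_comp_smul {φ : EuclideanSpace ℝ (Fin n) → ℝ} (hφ : Differentiable ℝ φ) (c : ℝ)
    (i : Fin n) : pd i (fun x => φ (c • x)) = fun x => c * pd i φ (c • x) := by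
  ext x
  have h := HasFDerivAt.comp (f := fun y => c • y) x (hφ (c • x)).hasFDerivAt
    ((hasFDerivAt_id x).const_smul c)
  have h' : fderiv ℝ (fun x => φ (c • x)) x = _ := h.fderiv
  simp [pd, h']

theorem pd_const_mul {φ : EuclideanSpace ℝ (Fin n) → ℝ} (hφ : Differentiable ℝ φ) (c : ℝ)
    (i : Fin n) : pd i (fun x => c * φ x) = fun x => c * pd i φ x := by
  ext x
  simp [pd, fderiv_const_mul (hφ x)]

theorem lap_const_mul {φ : EuclideanSpace ℝ (Fin n) → ℝ} (hφ : ContDiff ℝ 2 φ) (c : ℝ)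
    (x : EuclideanSpace ℝ (Fin n)) : Lap (fun x => c * φ x) x = c * Lap φ x := by
  rw [lap_eq_sum_pd (contDiff_const.mul hφ), lap_eq_sum_pd hφ, Finset.mul_sum]
  refine Finset.sum_congr rfl fun i _ => ?_
  rw [pd_const_mul (hφ.differentiable (by norm_num)),
    pd_const_mul ((hφ.pd (m := 1) (by norm_num) i).differentiable (by norm_num))]

theorem lap_comp_smul {φ : EuclideanSpace ℝ (Fin n) → ℝ} (hφ : ContDiff ℝ 2 φ) (c : ℝ)
    (x : EuclideanSpace ℝ (Fin n)) : Lap (fun x => φ (c • x)) x = c ^ 2 * Lap φ (c • x) := by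
  rw [lap_eq_sum_pd (f := fun x => φ (c • x)) (hφ.comp (contDiff_const_smul c)), lap_eq_sum_pd hφ, Finset.mul_sum]
  refine Finset.sum_congr rfl fun i _ => ?_
  have h1 := (hφ.pd (m := 1) (by norm_num) i).differentiable (by norm_num)
  rw [pd_comp_smul (hφ.differentiable (by norm_num)),
    pd_const_mul (φ := fun x => pd i φ (c • x)) (h1.comp (differentiable_id.const_smul c)),
    pd_comp_smul h1]
  ring

theorem exists_cutoff (n : ℕ) : ∃ a : ℝ, ∀ R : ℝ, 0 < R →
    ∃ g : EuclideanSpace ℝ (Fin n) → ℝ, ContDiff ℝ 2 g ∧ HasCompactSupport g ∧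
      tsupport g ⊆ closedBall 0 (2 * R) ∧ (∀ x ∈ closedBall 0 R, g x = 1) ∧
      (∀ x, 0 ≤ g x) ∧ (∀ x, g x ≤ 1) ∧ (∀ x, ∑ i, pd i g x ^ 2 ≤ a / R ^ 2) ∧
      ∀ x, |Lap g x| ≤ a / R ^ 2 := by
  let φ : ContDiffBump (0 : EuclideanSpace ℝ (Fin n)) := ⟨1, 2, one_pos, one_lt_two⟩
  have hφ : ContDiff ℝ 2 φ := φ.contDiff
  have hφs : HasCompactSupport φ := φ.hasCompactSupport
  have hpd : ∀ i, Continuous (pd i φ) := fun i => (hφ.pd (m := 1) (by norm_num) i).continuous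
  obtain ⟨A, hA⟩ := hφs.isCompact.exists_bound_of_continuousOn
    (f := fun x => ∑ i, pd i φ x ^ 2) (by fun_prop)
  obtain ⟨B, hB⟩ := hφs.isCompact.exists_bound_of_continuousOn 
    (hφ.lap (m := 0) (by norm_num)).continuous.continuousOn
  have hpd_off : ∀ x ∉ tsupport φ, ∀ i, pd i φ x = 0 := fun x hx i => by
    simp [pd, fderiv_of_notMem_tsupport ℝ hx]
  have hlap_off : ∀ x ∉ tsupport φ, Lap φ x = 0 := fun x hx => by
    rw [lap_eq_sum_pd hφ]
    refine Finset.sum_eq_zero fun i _ => ?_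
    have : x ∉ tsupport (pd i φ) := fun h => hx (tsupport_fderiv_apply_subset ℝ _ h)
    simp [pd, fderiv_of_notMem_tsupport ℝ this]
  have hA' : ∀ x, ∑ i, pd i φ x ^ 2 ≤ max (max A B) 0 := fun x => by
    by_cases hx : x ∈ tsupport φ
    · exact (le_abs_self _).trans ((hA x hx).trans (by simp))
    · simp [hpd_off x hx]
  have hB' : ∀ x, |Lap φ x| ≤ max (max A B) 0 := fun x => by
    by_cases hx : x ∈ tsupport φ
    · exact (hB x hx).trans (by simp)
    · simp [hlap_off x hx]
  refine ⟨max (max A B) 0, fun R hR => ⟨fun x => φ (R⁻¹ • x), ?_⟩⟩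
  have hsub : tsupport (fun x => φ (R⁻¹ • x)) ⊆ closedBall 0 (2 * R) := by
    refine closure_minimal (fun x hx => ?_) isClosed_closedBall
    have : R⁻¹ • x ∈ ball (0 : EuclideanSpace ℝ (Fin n)) 2 := by
      rw [← φ.support_eq]; exact hx
    rw [mem_ball_zero_iff, norm_smul, norm_inv, Real.norm_of_nonneg hR.le,
      inv_mul_lt_iff₀ hR] at this
    rw [mem_closedBall_zero_iff]
    linarith
  refine ⟨hφ.comp (contDiff_const_smul _),
    HasCompactSupport.of_support_subset_isCompact (isCompact_closedBall 0 (2 * R))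
      ((subset_tsupport _).trans hsub), hsub, fun x hx => ?_, fun x => φ.nonneg,
    fun x => φ.le_one, fun x => ?_, fun x => ?_⟩
  · refine φ.one_of_mem_closedBall ?_
    rw [mem_closedBall_zero_iff] at hx
    rw [mem_closedBall_zero_iff, norm_smul, norm_inv, Real.norm_of_nonneg hR.le,
      inv_mul_le_iff₀ hR]
    simpa [φ] using hx
  · simp only [pd_comp_smul (hφ.differentiable (by norm_num)), mul_pow, ← Finset.mul_sum]
    rw [inv_pow, inv_mul_eq_div]
    exact div_le_div_of_nonneg_right (hA' _) (by positivity)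
  · rw [lap_comp_smul hφ, abs_mul, abs_of_nonneg (by positivity), inv_pow, inv_mul_eq_div]
    exact div_le_div_of_nonneg_right (hB' _) (by positivity)

end Cutoff

section TimeEvolution

variable {n : ℕ}

theorem integral_intervalIntegral_swap_of_compact {F : EuclideanSpace ℝ (Fin n) × ℝ → ℝ}
    (hF : Continuous F) {K : Set (EuclideanSpace ℝ (Fin n))} (hK : IsCompact K)
    (h0 : ∀ x ∉ K, ∀ σ, F (x, σ) = 0) (s : ℝ) :
    ∫ x, ∫ σ in (0 : ℝ)..s, F (x, σ) = ∫ σ in (0 : ℝ)..s, ∫ x, F (x, σ) := by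
  have e1 : ∀ σ, ∫ x, F (x, σ) = ∫ x in K, F (x, σ) := fun σ =>
    (setIntegral_eq_integral_of_forall_compl_eq_zero fun x hx => h0 x hx σ).symm
  have e2 : ∫ x, ∫ σ in (0 : ℝ)..s, F (x, σ) = ∫ x in K, ∫ σ in (0 : ℝ)..s, F (x, σ) :=
    (setIntegral_eq_integral_of_forall_compl_eq_zero fun x hx => by simp [h0 x hx]).symm
  simp only [e1, e2]
  refine (MeasureTheory.intervalIntegral_integral_swap (f := fun σ x => F (x, σ)) ?_).symm
  rw [Measure.prod_restrict]
  refine IntegrableOn.mono_set (t := uIcc 0 s ×ˢ K) ?_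
    (Set.prod_mono uIoc_subset_uIcc subset_rfl)
  have hc : Continuous (Function.uncurry fun σ x => F (x, σ)) := by
    unfold Function.uncurry
    fun_prop
  exact hc.continuousOn.integrableOn_compact (isCompact_uIcc.prod hK)

theorem integral_cutoff_mul_sq_le {W w : EuclideanSpace ℝ (Fin n) × ℝ → ℝ} {ρ : ℝ → ℝ}
    (hW : Continuous W) (hw : ContDiff ℝ 2 w) (hρ : Continuous ρ)
    (hW2 : ∀ s, ContDiff ℝ 2 fun y => W (y, s))
    (hLap : ∀ s x, Lap (fun y => W (y, s)) x = - w (x, s))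
    (hderiv : ∀ x s, HasDerivAt (fun τ => W (x, τ)) (ρ s * spaceLap w (x, s)) s)
    (hW0 : ∀ x, W (x, 0) = 0) {S Θ a D : ℝ} (hS : ∀ σ ∈ Icc 0 S, 0 ≤ ρ σ ∧ ρ σ ≤ Θ)
    {g : EuclideanSpace ℝ (Fin n) → ℝ} (hg : ContDiff ℝ 2 g) (hs : HasCompactSupport g)
    (hg0 : ∀ x, 0 ≤ g x) (hg1 : ∀ x, g x ≤ 1) (hG : ∀ x, ∑ i, pd i g x ^ 2 ≤ a)
    (hl : ∀ x, |Lap g x| ≤ a)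
    (hD : ∀ σ ∈ Icc 0 S, ∫ x in tsupport g, W (x, σ) ^ 2 ≤ D) {s : ℝ} (hs' : s ∈ Icc 0 S) :
    ∫ x, g x ^ 4 * W (x, s) ^ 2 ≤ S * (Θ * (8960 * a ^ 2 * D)) := by
  have hSL : Continuous (spaceLap w) := (hw.spaceLap (m := 0) (by norm_num)).continuous
  have hgc := hg.continuous
  set F : EuclideanSpace ℝ (Fin n) × ℝ → ℝ := fun p =>
    ρ p.2 * (2 * (g p.1 ^ 4 * (W p * spaceLap w p))) with hFdef
  have hF : Continuous F := by fun_prop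
  have hF0 : ∀ x ∉ tsupport g, ∀ σ, F (x, σ) = 0 := fun x hx σ => by
    simp [hFdef, image_eq_zero_of_notMem_tsupport hx]
  have e1 : ∀ x, g x ^ 4 * W (x, s) ^ 2 = ∫ σ in (0 : ℝ)..s, F (x, σ) := fun x => by
    have h1 : ∀ σ ∈ uIcc 0 s, HasDerivAt (fun τ => g x ^ 4 * W (x, τ) ^ 2) (F (x, σ)) σ :=
      fun σ _ => by
        refine (((hderiv x σ).pow 2).const_mul (g x ^ 4)).congr_deriv ?_
        simp only [hFdef]
        push_cast
        ring
    rw [intervalIntegral.integral_eq_sub_of_hasDerivAt h1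
      ((hF.comp (Continuous.prodMk_right x)).intervalIntegrable _ _), hW0]
    ring
  simp only [e1]
  rw [integral_intervalIntegral_swap_of_compact hF hs hF0]
  have hD0 : 0 ≤ D :=
    (integral_nonneg fun x => sq_nonneg _).trans (hD s hs')
  have hΘ : 0 ≤ Θ := (hS s hs').1.trans (hS s hs').2
  have e2 : ∀ σ, ∫ x, F (x, σ) = ∫ x in tsupport g, F (x, σ) := fun σ =>
    (setIntegral_eq_integral_of_forall_compl_eq_zero fun x hx => hF0 x hx σ).symm
  have hcont : Continuous fun σ => ∫ x, F (x, σ) := by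
    simp only [e2]
    refine continuous_parametric_integral_of_continuous (f := fun σ x => F (x, σ)) ?_ hs
    unfold Function.uncurry
    fun_prop
  calc ∫ σ in (0 : ℝ)..s, ∫ x, F (x, σ)
      ≤ ∫ σ in (0 : ℝ)..s, Θ * (8960 * a ^ 2 * D) := by
        refine intervalIntegral.integral_mono_on hs'.1 (hcont.intervalIntegrable _ _)
          intervalIntegrable_const fun σ hσ => ?_
        have hσS : σ ∈ Icc 0 S := ⟨hσ.1, hσ.2.trans hs'.2⟩
        have h1 : ∫ x, F (x, σ) = ρ σ * ∫ x, 2 * (g x ^ 4 * (W (x, σ) *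
            Lap (fun y => w (y, σ)) x)) := by
          rw [← integral_const_mul]
          simp only [hFdef, lap_slice hw]
        have h2 := integral_cutoff_mul_lap_le (hW2 σ) (contDiff_slice hw σ) (hLap σ) hg hs hg0
          hg1 hG hl
        have h3 : 8960 * a ^ 2 * ∫ x in tsupport g, W (x, σ) ^ 2 ≤ 8960 * a ^ 2 * D :=
          mul_le_mul_of_nonneg_left (hD σ hσS) (by positivity)
        rw [h1]
        calc _ ≤ ρ σ * (8960 * a ^ 2 * D) :=
              mul_le_mul_of_nonneg_left (h2.trans h3) (hS σ hσS).1
          _ ≤ _ := mul_le_mul_of_nonneg_right (hS σ hσS).2 (by positivity)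
    _ = s * (Θ * (8960 * a ^ 2 * D)) := by
        rw [intervalIntegral.integral_const, smul_eq_mul, sub_zero]
    _ ≤ S * (Θ * (8960 * a ^ 2 * D)) := mul_le_mul_of_nonneg_right hs'.2 (by positivity)

theorem setIntegral_sq_le_of_bounded {W w : EuclideanSpace ℝ (Fin n) × ℝ → ℝ} {ρ : ℝ → ℝ}
    (hW : Continuous W) (hw : ContDiff ℝ 2 w) (hρ : Continuous ρ)
    (hW2 : ∀ s, ContDiff ℝ 2 fun y => W (y, s))
    (hLap : ∀ s x, Lap (fun y => W (y, s)) x = - w (x, s))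
    (hderiv : ∀ x s, HasDerivAt (fun τ => W (x, τ)) (ρ s * spaceLap w (x, s)) s)
    (hW0 : ∀ x, W (x, 0) = 0) {S Θ M : ℝ} (hS : ∀ σ ∈ Icc 0 S, 0 ≤ ρ σ ∧ ρ σ ≤ Θ)
    (hM : ∀ x, ∀ σ ∈ Icc 0 S, |W (x, σ)| ≤ M) (k : ℕ) :
    ∃ C : ℝ, ∀ R : ℝ, 0 < R → ∀ s ∈ Icc 0 S,
      ∫ x in closedBall 0 R, W (x, s) ^ 2 ≤ C * (R ^ n / R ^ (4 * k)) := by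
  have hint : ∀ R s, IntegrableOn (fun x => W (x, s) ^ 2) (closedBall 0 R) := fun R s =>
    ContinuousOn.integrableOn_compact (isCompact_closedBall 0 R) (by fun_prop)
  induction k with
  | zero =>
    refine ⟨M ^ 2 * volume.real (ball (0 : EuclideanSpace ℝ (Fin n)) 1), fun R hR s hs => ?_⟩
    calc ∫ x in closedBall 0 R, W (x, s) ^ 2
        ≤ ∫ x in closedBall (0 : EuclideanSpace ℝ (Fin n)) R, M ^ 2 :=
          integral_mono (hint R s)
            (integrableOn_const (isCompact_closedBall 0 R).measure_ne_top) fun x => by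
              simpa using sq_le_sq.2 ((hM x s hs).trans (le_abs_self M))
      _ = M ^ 2 * volume.real (ball (0 : EuclideanSpace ℝ (Fin n)) 1) *
            (R ^ n / R ^ (4 * 0)) := by
          rw [setIntegral_const, Measure.real, Measure.addHaar_closedBall _ _ hR.le,
            ENNReal.toReal_mul, ENNReal.toReal_ofReal (by positivity), finrank_euclideanSpace_fin,
            smul_eq_mul, Measure.real]
          simp
          ring
  | succ k ih =>
    obtain ⟨C, hC⟩ := ih
    obtain ⟨a, hcut⟩ := exists_cutoff n
    refine ⟨S * (Θ * (8960 * a ^ 2 * (C * (2 ^ n / 2 ^ (4 * k))))), fun R hR s hs => ?_⟩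
    obtain ⟨g, hg, hgs, hsub, hgone, hg0, hg1, hG, hl⟩ := hcut R hR
    have hgc := hg.continuous
    have key := integral_cutoff_mul_sq_le hW hw hρ hW2 hLap hderiv hW0 hS hg hgs hg0 hg1 hG hl
      (D := C * ((2 * R) ^ n / (2 * R) ^ (4 * k))) (fun σ hσ =>
        (setIntegral_mono_set (hint _ σ) (.of_forall fun x => sq_nonneg _)
          (.of_forall hsub)).trans (hC (2 * R) (by positivity) σ hσ)) hs
    calc ∫ x in closedBall 0 R, W (x, s) ^ 2
        = ∫ x in closedBall 0 R, g x ^ 4 * W (x, s) ^ 2 :=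
          setIntegral_congr_fun measurableSet_closedBall fun x hx => by simp [hgone x hx]
      _ ≤ ∫ x, g x ^ 4 * W (x, s) ^ 2 := by
          refine setIntegral_le_integral ?_ (.of_forall fun x => by positivity)
          refine Continuous.integrable_of_hasCompactSupport (by fun_prop)
            (HasCompactSupport.intro hgs fun x hx => ?_)
          simp [image_eq_zero_of_notMem_tsupport hx]
      _ ≤ _ := key
      _ = _ := by
          rw [mul_pow, mul_pow, mul_add, pow_add R]
          field_simp
          ring

theorem eq_zero_of_setIntegral_sq_le {f : EuclideanSpace ℝ (Fin n) → ℝ} (hf : Continuous f)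
    {C : ℝ} (h : ∀ R : ℝ, 0 < R →
      ∫ x in closedBall 0 R, f x ^ 2 ≤ C * (R ^ n / R ^ (4 * (n + 1)))) (x) : f x = 0 := by
  have hint : ∀ R, IntegrableOn (fun x => f x ^ 2) (closedBall 0 R) := fun R =>
    ContinuousOn.integrableOn_compact (isCompact_closedBall 0 R) (by fun_prop)
  have hlim : Filter.Tendsto (fun R : ℝ => C * (R ^ n / R ^ (4 * (n + 1)))) Filter.atTop
      (nhds 0) := by
    simpa using (tendsto_pow_div_pow_atTop_zero (𝕜 := ℝ) (p := n) (q := 4 * (n + 1))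
      (by omega)).const_mul C
  have hz : ∀ r, ∫ x in closedBall 0 r, f x ^ 2 = 0 := fun r => by
    refine le_antisymm (ge_of_tendsto hlim ?_) (integral_nonneg fun x => sq_nonneg _)
    filter_upwards [Filter.eventually_gt_atTop 0, Filter.eventually_ge_atTop r] with R hR hr
    exact (setIntegral_mono_set (hint R) (.of_forall fun x => sq_nonneg _)
      (.of_forall (closedBall_subset_closedBall hr))).trans (h R hR)
  by_contra hx
  have hpos : 0 < ∫ y in closedBall 0 (‖x‖ + 1), f y ^ 2 := by
    rw [setIntegral_pos_iff_support_of_nonneg_ae (.of_forall fun y => sq_nonneg _) (hint _)]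
    have ho : IsOpen (Function.support (fun y => f y ^ 2) ∩ ball 0 (‖x‖ + 1)) :=
      (by fun_prop : Continuous fun y => f y ^ 2).isOpen_support.inter isOpen_ball
    refine (ho.measure_pos volume ⟨x, ?_, ?_⟩).trans_le
      (measure_mono (inter_subset_inter_right _ ball_subset_closedBall))
    · simpa using hx
    · simp
  exact hpos.ne' (hz _)

end TimeEvolution

section Uniqueness

variable {n : ℕ}

theorem eq_zero_of_rescaled_biharmonic_heat {w : EuclideanSpace ℝ (Fin n) × ℝ → ℝ} {ρ : ℝ → ℝ}
    (hw : ContDiff ℝ 4 w) (hρ : ContDiff ℝ 2 ρ)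
    (hderiv : ∀ x s, HasDerivAt (fun τ => w (x, τ))
      (-(ρ s * Lap (Lap fun y => w (y, s)) x)) s)
    (hw0 : ∀ x, w (x, 0) = 0) {S Θ M : ℝ} (hS : ∀ σ ∈ Icc 0 S, 0 ≤ ρ σ ∧ ρ σ ≤ Θ)
    (hM : ∀ x, ∀ σ ∈ Icc 0 S, |ρ σ * Lap (fun y => w (y, σ)) x| ≤ M)
    (x : EuclideanSpace ℝ (Fin n)) {s : ℝ} (hs : s ∈ Icc 0 S) : w (x, s) = 0 := by
  have hw2 : ContDiff ℝ 2 w := hw.of_le (by norm_num)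
  have hSL : ContDiff ℝ 2 (spaceLap w) := hw.spaceLap (by norm_num)
  set G : EuclideanSpace ℝ (Fin n) × ℝ → ℝ := fun p => ρ p.2 * spaceLap w p with hGdef
  have hG : ContDiff ℝ 2 G := (hρ.comp contDiff_snd).mul hSL
  set W : EuclideanSpace ℝ (Fin n) × ℝ → ℝ := fun p => ∫ σ in (0 : ℝ)..p.2, G (p.1, σ) with hWdef
  have hGs : ∀ x, Continuous fun σ => G (x, σ) := fun x =>
    hG.continuous.comp (Continuous.prodMk_right x)
  have hW : Continuous W :=
    intervalIntegral.continuous_parametric_primitive_of_continuous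
      (f := fun x σ => G (x, σ)) hG.continuous
  have hW2 : ∀ s, ContDiff ℝ 2 fun y => W (y, s) := fun s =>
    contDiff_intervalIntegral_slice 2 hG s
  have hslap : ∀ x σ, spaceLap G (x, σ) = ρ σ * Lap (Lap fun y => w (y, σ)) x := fun x σ => by
    have e : (Lap fun y => w (y, σ)) = fun y => spaceLap w (y, σ) := funext (lap_slice hw2 σ)
    rw [← lap_slice hG, e, ← lap_const_mul (contDiff_slice hSL σ)]
  have hLap : ∀ s x, Lap (fun y => W (y, s)) x = - w (x, s) := fun s x => by
    have h1 : ∀ σ ∈ uIcc 0 s, HasDerivAt (fun τ => -w (x, τ)) (spaceLap G (x, σ)) σ :=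
      fun σ _ => (hderiv x σ).neg.congr_deriv (by rw [hslap, neg_neg])
    have h2 : Continuous fun σ => spaceLap G (x, σ) :=
      (hG.spaceLap (m := 0) (by norm_num)).continuous.comp (Continuous.prodMk_right x)
    rw [hWdef, lap_intervalIntegral hG, intervalIntegral.integral_eq_sub_of_hasDerivAt h1
      (h2.intervalIntegrable _ _), hw0]
    ring
  have hWd : ∀ x s, HasDerivAt (fun τ => W (x, τ)) (ρ s * spaceLap w (x, s)) s := fun x s =>
    ((hGs x).integral_hasStrictDerivAt 0 s).hasDerivAt
  have hWb : ∀ x, ∀ σ ∈ Icc 0 S, |W (x, σ)| ≤ M * S := fun x σ hσ => by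
    have h1 := intervalIntegral.norm_integral_le_of_norm_le_const (a := 0) (b := σ) (C := M)
      (f := fun σ => G (x, σ)) fun τ hτ => by
        rw [uIoc_of_le hσ.1] at hτ
        have := hM x τ ⟨hτ.1.le, hτ.2.trans hσ.2⟩
        rwa [lap_slice hw2] at this
    rw [sub_zero, abs_of_nonneg hσ.1] at h1
    exact h1.trans (mul_le_mul_of_nonneg_left hσ.2 ((abs_nonneg _).trans (hM x σ hσ)))
  obtain ⟨C, hC⟩ := setIntegral_sq_le_of_bounded hW hw2 hρ.continuous hW2 hLap hWd
    (fun x => by simp [hWdef]) hS hWb (n + 1)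
  have hWz : (fun y => W (y, s)) = fun _ => 0 :=
    funext (eq_zero_of_setIntegral_sq_le (hW2 s).continuous fun R hR => hC R hR s hs)
  have h := hLap s x
  rw [hWz] at h
  have h0 : Lap (fun _ : EuclideanSpace ℝ (Fin n) => (0 : ℝ)) x = 0 := by
    simpa using lap_const_mul (φ := fun _ => 0) contDiff_const 0 x
  linarith

end Uniqueness

/-- **Theorem (uniqueness for the biharmonic heat equation).** Smooth solutions `u, v` of
`∂ₜ u = -Δ² u` on `ℝⁿ × [0,T]` with `|Δv|²(x,t) + |Δu|²(x,t) ≤ k₀/t` for all `x`,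
`t ∈ (0,T]`, and equal initial data, coincide. -/
theorem biharmonic_uniqueness (n : ℕ) (T : ℝ) (hT : 0 < T)
    (u v : EuclideanSpace ℝ (Fin n) → ℝ → ℝ) (k₀ : ℝ)
    (hu : ContDiffOn ℝ (⊤ : ℕ∞) (fun p : EuclideanSpace ℝ (Fin n) × ℝ => u p.1 p.2)
      (Set.univ ×ˢ Set.Icc 0 T))
    (hv : ContDiffOn ℝ (⊤ : ℕ∞) (fun p : EuclideanSpace ℝ (Fin n) × ℝ => v p.1 p.2)
      (Set.univ ×ˢ Set.Icc 0 T))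
    (hequ : ∀ x : EuclideanSpace ℝ (Fin n), ∀ t ∈ Set.Icc (0 : ℝ) T,
      HasDerivWithinAt (fun τ => u x τ) (-(iterLap 2 (fun y => u y t) x)) (Set.Icc 0 T) t)
    (heqv : ∀ x : EuclideanSpace ℝ (Fin n), ∀ t ∈ Set.Icc (0 : ℝ) T,
      HasDerivWithinAt (fun τ => v x τ) (-(iterLap 2 (fun y => v y t) x)) (Set.Icc 0 T) t)
    (hk₀ : ∀ x : EuclideanSpace ℝ (Fin n), ∀ t ∈ Set.Ioc (0 : ℝ) T,
      (Lap (fun y => v y t) x) ^ 2 + (Lap (fun y => u y t) x) ^ 2 ≤ k₀ / t)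
    (h0 : ∀ x : EuclideanSpace ℝ (Fin n), u x 0 = v x 0) :
    ∀ x : EuclideanSpace ℝ (Fin n), ∀ t ∈ Set.Icc (0 : ℝ) T, u x t = v x t := by
  set θ : ℝ → ℝ := fun s => T * Real.sin s ^ 2 with hθ
  set ρ : ℝ → ℝ := fun s => T * (2 * Real.sin s * Real.cos s) with hρ
  have hθd : ∀ s, HasDerivAt θ (ρ s) s := fun s => by
    refine (((Real.hasDerivAt_sin s).pow 2).const_mul T).congr_deriv ?_
    simp [hρ]
  have hθc : ContDiff ℝ (⊤ : ℕ∞) θ := contDiff_const.mul (Real.contDiff_sin.pow 2)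
  have hρc : ContDiff ℝ 2 ρ :=
    contDiff_const.mul ((contDiff_const.mul Real.contDiff_sin).mul Real.contDiff_cos)
  have hθm : ∀ s, θ s ∈ Icc 0 T := fun s =>
    ⟨by positivity, mul_le_of_le_one_right hT.le (Real.sin_sq_le_one s)⟩
  have hmap : ContDiff ℝ (⊤ : ℕ∞) fun p : EuclideanSpace ℝ (Fin n) × ℝ => (p.1, θ p.2) :=
    contDiff_fst.prodMk (hθc.comp contDiff_snd)
  have hmapm : ∀ p : EuclideanSpace ℝ (Fin n) × ℝ, (p.1, θ p.2) ∈ univ ×ˢ Icc 0 T :=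
    fun p => ⟨mem_univ _, hθm p.2⟩
  have h4 : (4 : WithTop ℕ∞) ≤ ((⊤ : ℕ∞) : WithTop ℕ∞) := WithTop.coe_le_coe.2 le_top
  have hus : ∀ t ∈ Icc 0 T, ContDiff ℝ 4 fun y => u y t := fun t ht =>
    (hu.comp_contDiff (contDiff_prodMk_left t) fun y => ⟨mem_univ _, ht⟩).of_le h4
  have hvs : ∀ t ∈ Icc 0 T, ContDiff ℝ 4 fun y => v y t := fun t ht =>
    (hv.comp_contDiff (contDiff_prodMk_left t) fun y => ⟨mem_univ _, ht⟩).of_le h4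
  have hL : ∀ t ∈ Icc 0 T, (Lap fun y => u y t - v y t) =
      fun y => Lap (fun y => u y t) y - Lap (fun y => v y t) y := fun t ht =>
    funext (lap_sub ((hus t ht).of_le (by norm_num)) ((hvs t ht).of_le (by norm_num)))
  set w : EuclideanSpace ℝ (Fin n) × ℝ → ℝ := fun p => u p.1 (θ p.2) - v p.1 (θ p.2) with hw
  have hwc : ContDiff ℝ 4 w :=
    ((hu.comp_contDiff hmap hmapm).sub (hv.comp_contDiff hmap hmapm)).of_le h4
  have hderiv : ∀ x s, HasDerivAt (fun τ => w (x, τ))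
      (-(ρ s * Lap (Lap fun y => w (y, s)) x)) s := fun x s => by
    have h1 := (hequ x (θ s) (hθm s)).comp_hasDerivAt s (hθd s) (.of_forall hθm)
    have h2 := (heqv x (θ s) (hθm s)).comp_hasDerivAt s (hθd s) (.of_forall hθm)
    refine (h1.sub h2).congr_deriv ?_
    rw [hL _ (hθm s), lap_sub ((hus _ (hθm s)).lap (by norm_num))
      ((hvs _ (hθm s)).lap (by norm_num))]
    simp only [iterLap, Function.iterate_succ, Function.iterate_zero, Function.comp, id]
    ring
  have hpi : ∀ σ ∈ Icc 0 (Real.pi / 2), 0 ≤ Real.sin σ ∧ 0 ≤ Real.cos σ := fun σ hσ =>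
    ⟨Real.sin_nonneg_of_mem_Icc ⟨hσ.1, by linarith [hσ.2, Real.pi_pos]⟩,
      Real.cos_nonneg_of_mem_Icc ⟨by linarith [hσ.1, Real.pi_pos], hσ.2⟩⟩
  have hS : ∀ σ ∈ Icc 0 (Real.pi / 2), 0 ≤ ρ σ ∧ ρ σ ≤ T := fun σ hσ => by
    obtain ⟨h1, h2⟩ := hpi σ hσ
    refine ⟨by positivity, mul_le_of_le_one_right hT.le ?_⟩
    nlinarith [Real.sin_sq_add_cos_sq σ, sq_nonneg (Real.sin σ - Real.cos σ)]
  have hM : ∀ x, ∀ σ ∈ Icc 0 (Real.pi / 2),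
      |ρ σ * Lap (fun y => w (y, σ)) x| ≤ √(8 * (T * |k₀|)) := fun x σ hσ => by
    refine Real.abs_le_sqrt ?_
    rcases (hpi σ hσ).1.eq_or_lt with h | h
    · have : ρ σ = 0 := by simp [hρ, ← h]
      rw [this, zero_mul, zero_pow two_ne_zero]
      positivity
    · have hθpos : 0 < θ σ := mul_pos hT (pow_pos h 2)
      have h1 := hk₀ x (θ σ) ⟨hθpos, (hθm σ).2⟩
      rw [le_div_iff₀ hθpos] at h1
      rw [hL _ (hθm σ)]
      set p := Lap (fun y => u y (θ σ)) x
      set q := Lap (fun y => v y (θ σ)) x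
      have h2 : (p - q) ^ 2 * θ σ ≤ 2 * |k₀| := by
        nlinarith [mul_nonneg (sq_nonneg (p + q)) hθpos.le, le_abs_self k₀]
      have h3 : Real.cos σ ^ 2 ≤ 1 := Real.cos_sq_le_one σ
      calc (ρ σ * (p - q)) ^ 2 = 4 * T * Real.cos σ ^ 2 * ((p - q) ^ 2 * θ σ) := by
            simp only [hρ, hθ]; ring
        _ ≤ 4 * T * 1 * (2 * |k₀|) := by gcongr
        _ = 8 * (T * |k₀|) := by ring
  intro x t ht
  have ht1 : t / T ∈ Icc 0 1 := ⟨div_nonneg ht.1 hT.le, (div_le_one hT).2 ht.2⟩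
  have hsq : √(t / T) ≤ 1 := Real.sqrt_le_one.2 ht1.2
  have hsq0 := Real.sqrt_nonneg (t / T)
  have hθt : θ (Real.arcsin √(t / T)) = t := by
    simp only [hθ]
    rw [Real.sin_arcsin (by linarith) hsq, Real.sq_sqrt ht1.1]
    field_simp
  have h := eq_zero_of_rescaled_biharmonic_heat hwc hρc hderiv
    (fun x => by simp [hw, hθ, h0]) hS hM x (s := Real.arcsin √(t / T))
    ⟨Real.arcsin_nonneg.2 hsq0, Real.arcsin_le_pi_div_two _⟩
  simp only [hw, hθt] at h
  exact sub_eq_zero.1 h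
end
end

section
/- Let u ∈ C^∞(ℝⁿ) and let k ∈ ℕ with k ≥ 1. Let s > 8, ρ > 0, and let γ ∈ C^∞(ℝⁿ) satisfy χ_{B_ρ(0)} ≤ γ ≤ χ_{B_{2ρ}(0)}, |∇γ| ≤ c_γ/ρ and |∇²γ| ≤ c_γ/ρ², where c_γ ≥ 1 is a constant depending only on n; set η = γˢ. Then for every ε > 0 there is a constant c₁ = c₁(ε,s,n) < ∞ such that -2 ∫_{ℝⁿ} (Δ^{k+1}u)(∇ᵢΔᵏu)(∇ᵢη) dx ≤ ε ∫_{ℝⁿ} |Δ^{k+1}u|² η dx + (c₁/ρ⁸) ∫_{ℝⁿ} |Δ^{k-1}u|² γ^{s-8} dx. -/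
open MeasureTheory Metric Set

noncomputable section

/-- Partial derivative of `f` in the `i`-th coordinate direction. -/
def pderiv1 {n : ℕ} (i : Fin n) (f : EuclideanSpace ℝ (Fin n) → ℝ)
    (x : EuclideanSpace ℝ (Fin n)) : ℝ :=
  fderiv ℝ f x (EuclideanSpace.single i (1 : ℝ))

/-- A smooth cutoff function `γ` as in `(γ)`: `χ_{B_ρ(0)} ≤ γ ≤ χ_{B_{2ρ}(0)}`,
`|∇γ| ≤ c_γ/ρ` and `|∇²γ| ≤ c_γ/ρ²`. -/
structure IsCutoff {n : ℕ} (γ : EuclideanSpace ℝ (Fin n) → ℝ) (ρ cγ : ℝ) : Prop where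
  smooth : ContDiff ℝ (⊤ : ℕ∞) γ
  lower : ∀ x, Set.indicator (Metric.ball (0 : EuclideanSpace ℝ (Fin n)) ρ) 1 x ≤ γ x
  upper : ∀ x, γ x ≤ Set.indicator (Metric.ball (0 : EuclideanSpace ℝ (Fin n)) (2 * ρ)) 1 x
  grad : ∀ x, ‖fderiv ℝ γ x‖ ≤ cγ / ρ
  hess : ∀ x, ‖iteratedFDeriv ℝ 2 γ x‖ ≤ cγ / ρ ^ 2

variable {n : ℕ}

theorem contDiff_pderiv1 {f : EuclideanSpace ℝ (Fin n) → ℝ} (hf : ContDiff ℝ (⊤ : ℕ∞) f)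
    (i : Fin n) : ContDiff ℝ (⊤ : ℕ∞) (pderiv1 i f) :=
  (hf.fderiv_right (m := (⊤ : ℕ∞)) (by norm_cast)).clm_apply contDiff_const

theorem Lap_eq_sum_pderiv1 {f : EuclideanSpace ℝ (Fin n) → ℝ} (hf : ContDiff ℝ (⊤ : ℕ∞) f)
    (x : EuclideanSpace ℝ (Fin n)) : Lap f x = ∑ i, pderiv1 i (pderiv1 i f) x := by
  unfold Lap
  refine Finset.sum_congr rfl fun i _ => ?_
  have hd : DifferentiableAt ℝ (fderiv ℝ f) x :=
    (hf.fderiv_right (m := (⊤ : ℕ∞)) (by norm_cast)).differentiable (by simp) x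
  rw [iteratedFDeriv_two_apply]
  unfold pderiv1
  rw [fderiv_clm_apply hd (differentiableAt_const _)]
  simp

theorem contDiff_Lap {f : EuclideanSpace ℝ (Fin n) → ℝ} (hf : ContDiff ℝ (⊤ : ℕ∞) f) :
    ContDiff ℝ (⊤ : ℕ∞) (Lap f) := by
  rw [show Lap f = fun x => ∑ i, pderiv1 i (pderiv1 i f) x from
    funext fun x => Lap_eq_sum_pderiv1 hf x]
  exact ContDiff.sum fun i _ => contDiff_pderiv1 (contDiff_pderiv1 hf i) i

theorem iterLap_succ (k : ℕ) (f : EuclideanSpace ℝ (Fin n) → ℝ) :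
    iterLap (k + 1) f = Lap (iterLap k f) :=
  Function.iterate_succ_apply' _ _ _

theorem contDiff_iterLap {f : EuclideanSpace ℝ (Fin n) → ℝ} (hf : ContDiff ℝ (⊤ : ℕ∞) f)
    (k : ℕ) : ContDiff ℝ (⊤ : ℕ∞) (iterLap k f) := by
  induction k with
  | zero => exact hf
  | succ k ih => rw [iterLap_succ]; exact contDiff_Lap ih

/-- Green's first identity against a compactly supported `C¹` function. -/
theorem integral_Lap_mul {f g : EuclideanSpace ℝ (Fin n) → ℝ} (hf : ContDiff ℝ (⊤ : ℕ∞) f)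
    (hg : ContDiff ℝ 1 g) (hgc : HasCompactSupport g) :
    ∫ x, Lap f x * g x = -∫ x, ∑ i, pderiv1 i f x * pderiv1 i g x := by
  have hg' (i : Fin n) : Continuous (pderiv1 i g) :=
    (hg.continuous_fderiv one_ne_zero).clm_apply continuous_const
  have hgc' (i : Fin n) : HasCompactSupport (pderiv1 i g) := hgc.fderiv_apply ℝ _
  have hcf (i : Fin n) := contDiff_pderiv1 hf i
  have int₁ (i : Fin n) : Integrable fun x => pderiv1 i (pderiv1 i f) x * g x :=
    ((contDiff_pderiv1 (hcf i) i).continuous.mul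
      hg.continuous).integrable_of_hasCompactSupport hgc.mul_left
  have int₂ (i : Fin n) : Integrable fun x => pderiv1 i f x * pderiv1 i g x :=
    ((hcf i).continuous.mul (hg' i)).integrable_of_hasCompactSupport (hgc' i).mul_left
  have int₃ (i : Fin n) : Integrable fun x => pderiv1 i f x * g x :=
    ((hcf i).continuous.mul hg.continuous).integrable_of_hasCompactSupport hgc.mul_left
  simp_rw [Lap_eq_sum_pderiv1 hf, Finset.sum_mul]
  rw [integral_finsetSum _ fun i _ => int₁ i, integral_finsetSum _ fun i _ => int₂ i,
    ← Finset.sum_neg_distrib]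
  refine Finset.sum_congr rfl fun i _ => ?_
  have := integral_mul_fderiv_eq_neg_fderiv_mul_of_integrable (μ := volume)
    (v := EuclideanSpace.single i (1 : ℝ)) (int₁ i) (int₂ i) (int₃ i)
    (fun x _ => (hcf i).differentiable (by simp) x)
    (fun x _ => hg.differentiable one_ne_zero x)
  exact (neg_eq_iff_eq_neg.mpr this).symm

namespace IsCutoff

variable {γ : EuclideanSpace ℝ (Fin n) → ℝ} {ρ cγ : ℝ}

theorem nonneg (hγ : IsCutoff γ ρ cγ) (x : EuclideanSpace ℝ (Fin n)) : 0 ≤ γ x :=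
  (Set.indicator_nonneg (fun _ _ => zero_le_one) x).trans (hγ.lower x)

theorem hasCompactSupport (hγ : IsCutoff γ ρ cγ) : HasCompactSupport γ := by
  refine HasCompactSupport.intro (isCompact_closedBall 0 (2 * ρ)) fun x hx => ?_
  have h := hγ.upper x
  rw [Set.indicator_of_notMem fun h => hx (ball_subset_closedBall h)] at h
  exact le_antisymm h (hγ.nonneg x)

theorem hasCompactSupport_rpow (hγ : IsCutoff γ ρ cγ) {q : ℝ} (hq : 0 < q) :
    HasCompactSupport fun x => γ x ^ q :=
  hγ.hasCompactSupport.comp_left (g := fun y : ℝ => y ^ q) (Real.zero_rpow hq.ne')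

theorem continuous_rpow (hγ : IsCutoff γ ρ cγ) {q : ℝ} (hq : 0 < q) :
    Continuous fun x => γ x ^ q :=
  hγ.smooth.continuous.rpow_const fun _ => Or.inr hq.le

theorem contDiff_rpow (hγ : IsCutoff γ ρ cγ) {q : ℝ} (hq : 1 ≤ q) :
    ContDiff ℝ 1 fun x => γ x ^ q :=
  (hγ.smooth.of_le (by norm_cast)).rpow_const_of_le (m := 1) (by simpa using hq)

theorem pderiv1_rpow (hγ : IsCutoff γ ρ cγ) {q : ℝ} (hq : 1 ≤ q) (i : Fin n)
    (x : EuclideanSpace ℝ (Fin n)) :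
    pderiv1 i (fun y => γ y ^ q) x = q * γ x ^ (q - 1) * pderiv1 i γ x := by
  have h := (hγ.smooth.differentiable (by simp) x).hasFDerivAt.rpow_const (p := q) (Or.inr hq)
  simp [pderiv1, h.fderiv]

theorem sum_sq_pderiv1_le (hγ : IsCutoff γ ρ cγ) (hρ : 0 < ρ)
    (x : EuclideanSpace ℝ (Fin n)) :
    ∑ i, (ρ * pderiv1 i γ x) ^ 2 ≤ n * cγ ^ 2 := by
  have key (i : Fin n) : (ρ * pderiv1 i γ x) ^ 2 ≤ cγ ^ 2 := by
    have h₁ : |pderiv1 i γ x| ≤ cγ / ρ := by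
      have h := (fderiv ℝ γ x).le_opNorm (EuclideanSpace.single i (1 : ℝ))
      simp only [PiLp.norm_single, norm_one, mul_one] at h
      exact h.trans (hγ.grad x)
    rw [le_div_iff₀ hρ] at h₁
    refine sq_le_sq' ?_ ?_ <;> nlinarith [neg_abs_le (pderiv1 i γ x), le_abs_self (pderiv1 i γ x)]
  simpa using Finset.sum_le_sum fun i (_ : i ∈ Finset.univ) => key i

end IsCutoff

/-- The function `f γ^{s/2-m} / ρᵐ`: the scale-invariant weighting of a quantity that is `m`
derivatives below the top order. -/
def weighted (γ : EuclideanSpace ℝ (Fin n) → ℝ) (ρ s : ℝ) (m : ℕ)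
    (f : EuclideanSpace ℝ (Fin n) → ℝ) : EuclideanSpace ℝ (Fin n) → ℝ :=
  fun x => f x * γ x ^ (s / 2 - m) / ρ ^ m

section weighted

variable {γ : EuclideanSpace ℝ (Fin n) → ℝ} {ρ cγ s : ℝ} {m : ℕ}
  {f h : EuclideanSpace ℝ (Fin n) → ℝ}

theorem continuous_weighted (hγ : IsCutoff γ ρ cγ) (hm : m < s / 2) (hf : Continuous f) :
    Continuous (weighted γ ρ s m f) :=
  (hf.mul (hγ.continuous_rpow (sub_pos.2 hm))).div_const _

theorem hasCompactSupport_weighted (hγ : IsCutoff γ ρ cγ) (hm : m < s / 2) :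
    HasCompactSupport (weighted γ ρ s m f) := by
  have : weighted γ ρ s m f = fun x => γ x ^ (s / 2 - m) * (f x / ρ ^ m) := by
    funext x; unfold weighted; ring
  rw [this]
  exact (hγ.hasCompactSupport_rpow (sub_pos.2 hm)).mul_right

theorem integrable_weighted_mul (hγ : IsCutoff γ ρ cγ) (hm : m < s / 2) (hf : Continuous f)
    (hh : Continuous h) : Integrable fun x => weighted γ ρ s m f x * h x :=
  ((continuous_weighted hγ hm hf).mul hh).integrable_of_hasCompactSupport
    (hasCompactSupport_weighted hγ hm).mul_right

theorem integral_sq_weighted (hγ : IsCutoff γ ρ cγ) (hm : m < s / 2) :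
    ∫ x, weighted γ ρ s m f x ^ 2 = 1 / ρ ^ (2 * m) * ∫ x, f x ^ 2 * γ x ^ (s - 2 * m) := by
  rw [← integral_const_mul]
  refine integral_congr_ae (.of_forall fun x => ?_)
  have e : γ x ^ (s - 2 * m) = γ x ^ (s / 2 - m) * γ x ^ (s / 2 - m) := by
    have hm' := sub_pos.2 hm
    rw [← Real.rpow_add_of_nonneg (hγ.nonneg x) hm'.le hm'.le]
    ring_nf
  simp only [weighted, e]
  ring

/-- Green's first identity with the cutoff weights distributed over the factors. -/
theorem integral_weighted_Lap_mul (hγ : IsCutoff γ ρ cγ) (hρ : 0 < ρ) {i j : ℕ}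
    (hi : (i + 1 : ℕ) < s / 2) (hj : (j + 1 : ℕ) < s / 2) (hij : 1 ≤ s - i - j - 1)
    (hf : ContDiff ℝ (⊤ : ℕ∞) f) (hh : ContDiff ℝ (⊤ : ℕ∞) h) :
    ∫ x, weighted γ ρ s i (Lap f) x * weighted γ ρ s (j + 1) h x =
      -(∫ x, ∑ l, weighted γ ρ s (i + 1) (pderiv1 l f) x * weighted γ ρ s j (pderiv1 l h) x)
      - (s - i - j - 1) * ∫ x, ∑ l, weighted γ ρ s (i + 1) (pderiv1 l f) x *
          (weighted γ ρ s (j + 1) h x * (ρ * pderiv1 l γ x)) := by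
  have hj' : (j : ℝ) < s / 2 := by push_cast at hj; linarith
  have hi' : (i : ℝ) < s / 2 := by push_cast at hi; linarith
  have hγc (l : Fin n) := (contDiff_pderiv1 hγ.smooth l).continuous
  have int₁ : Integrable fun x => ∑ l, weighted γ ρ s (i + 1) (pderiv1 l f) x *
      weighted γ ρ s j (pderiv1 l h) x :=
    integrable_finsetSum _ fun l _ => integrable_weighted_mul hγ hi
      (contDiff_pderiv1 hf l).continuous
      (continuous_weighted hγ hj' (contDiff_pderiv1 hh l).continuous)
  have int₂ : Integrable fun x => ∑ l, weighted γ ρ s (i + 1) (pderiv1 l f) x *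
      (weighted γ ρ s (j + 1) h x * (ρ * pderiv1 l γ x)) :=
    integrable_finsetSum _ fun l _ => integrable_weighted_mul hγ hi
      (contDiff_pderiv1 hf l).continuous
      ((continuous_weighted hγ hj hh.continuous).mul (continuous_const.mul (hγc l)))
  have green := integral_Lap_mul hf ((hh.of_le (by norm_cast)).mul
    (hγ.contDiff_rpow hij)) (hγ.hasCompactSupport_rpow (zero_lt_one.trans_le hij)).mul_left
  have split (x : EuclideanSpace ℝ (Fin n)) {p q r : ℝ} (hp : 0 < p) (hq : 0 < q)
      (h : r = p + q) : γ x ^ r = γ x ^ p * γ x ^ q := by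
    rw [h, Real.rpow_add_of_nonneg (hγ.nonneg x) hp.le hq.le]
  have hρ' := hρ.ne'
  rw [← integral_const_mul, ← integral_neg, ← integral_sub int₁.fun_neg (int₂.const_mul _)]
  trans 1 / ρ ^ (i + j + 1) * ∫ x, Lap f x * (h x * γ x ^ (s - i - j - 1))
  · rw [← integral_const_mul]
    refine integral_congr_ae (.of_forall fun x => ?_)
    simp only [weighted]
    rw [split x (r := s - i - j - 1) (sub_pos.2 hi') (sub_pos.2 hj) (by push_cast; ring)]
    field_simp
    ring
  · rw [green, ← integral_neg, ← integral_const_mul]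
    refine integral_congr_ae (.of_forall fun x => ?_)
    simp only [Finset.mul_sum, ← Finset.sum_neg_distrib, ← Finset.sum_sub_distrib]
    refine Finset.sum_congr rfl fun l _ => ?_
    have prod : pderiv1 l (fun y => h y * γ y ^ (s - i - j - 1)) x =
        pderiv1 l h x * γ x ^ (s - i - j - 1) +
          h x * ((s - i - j - 1) * γ x ^ (s - i - j - 1 - 1) * pderiv1 l γ x) := by
      rw [← hγ.pderiv1_rpow hij]
      unfold pderiv1
      rw [fderiv_fun_mul (hh.differentiable (by simp) x)
        ((hγ.contDiff_rpow hij).differentiable one_ne_zero x)]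
      simp
      ring
    rw [prod, split x (r := s - i - j - 1) (sub_pos.2 hi) (sub_pos.2 hj') (by push_cast; ring),
      split x (r := s - i - j - 1 - 1) (sub_pos.2 hi) (sub_pos.2 hj) (by push_cast; ring)]
    simp only [weighted]
    field_simp
    ring

theorem integral_mul_pderiv1_mul_pderiv1_rpow (hγ : IsCutoff γ ρ cγ) (hρ : 0 < ρ) (hs : 2 < s)
    (f h : EuclideanSpace ℝ (Fin n) → ℝ) :
    ∫ x, ∑ l, f x * pderiv1 l h x * pderiv1 l (fun y => γ y ^ s) x =
      s * ∫ x, ∑ l, weighted γ ρ s 1 (pderiv1 l h) x *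
        (weighted γ ρ s 0 f x * (ρ * pderiv1 l γ x)) := by
  rw [← integral_const_mul]
  refine integral_congr_ae (.of_forall fun x => ?_)
  simp only [Finset.mul_sum]
  refine Finset.sum_congr rfl fun l _ => ?_
  have e : γ x ^ (s - 1) = γ x ^ (s / 2 - (1 : ℕ)) * γ x ^ (s / 2 - (0 : ℕ)) := by
    rw [← Real.rpow_add_of_nonneg (hγ.nonneg x) (by push_cast; linarith)
      (by push_cast; linarith)]
    push_cast
    ring_nf
  have hρ' := hρ.ne'
  rw [hγ.pderiv1_rpow (by linarith), e]
  simp only [weighted]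
  field_simp

end weighted

theorem neg_two_mul_le_young {t : ℝ} (ht : 0 < t) (a b : ℝ) :
    -2 * (a * b) ≤ t * a ^ 2 + t⁻¹ * b ^ 2 := by
  have h : t * a ^ 2 + t⁻¹ * b ^ 2 + 2 * (a * b) = t * (a + t⁻¹ * b) ^ 2 := by
    field_simp
    ring
  nlinarith [mul_nonneg ht.le (sq_nonneg (a + t⁻¹ * b))]

theorem neg_two_integral_le {X : Type*} [MeasurableSpace X] {μ : Measure X} {F P Q : X → ℝ}
    (hF : Integrable F μ) (hP : Integrable P μ) (hQ : Integrable Q μ) {t r : ℝ}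
    (h : ∀ x, -2 * F x ≤ t * P x + r * Q x) :
    -2 * ∫ x, F x ∂μ ≤ t * (∫ x, P x ∂μ) + r * ∫ x, Q x ∂μ := by
  simp only [← integral_const_mul]
  rw [← integral_add (hP.const_mul _) (hQ.const_mul _)]
  exact integral_mono (hF.const_mul _) ((hP.const_mul _).add (hQ.const_mul _)) h

section young

variable {γ : EuclideanSpace ℝ (Fin n) → ℝ} {ρ cγ s t : ℝ} {i j : ℕ}
  {f h : EuclideanSpace ℝ (Fin n) → ℝ} {F H : Fin n → EuclideanSpace ℝ (Fin n) → ℝ}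

theorem integrable_sq_weighted (hγ : IsCutoff γ ρ cγ) (hi : i < s / 2)
    (hf : ContDiff ℝ (⊤ : ℕ∞) f) : Integrable fun x => weighted γ ρ s i f x ^ 2 := by
  simp only [pow_two]
  exact integrable_weighted_mul hγ hi hf.continuous (continuous_weighted hγ hi hf.continuous)

theorem neg_two_integral_weighted_mul_le (hγ : IsCutoff γ ρ cγ) (hi : i < s / 2)
    (hj : j < s / 2) (hf : ContDiff ℝ (⊤ : ℕ∞) f) (hh : ContDiff ℝ (⊤ : ℕ∞) h) (ht : 0 < t) :
    -2 * ∫ x, weighted γ ρ s i f x * weighted γ ρ s j h x ≤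
      t * (∫ x, weighted γ ρ s i f x ^ 2) + t⁻¹ * ∫ x, weighted γ ρ s j h x ^ 2 :=
  neg_two_integral_le
    (integrable_weighted_mul hγ hi hf.continuous (continuous_weighted hγ hj hh.continuous))
    (integrable_sq_weighted hγ hi hf) (integrable_sq_weighted hγ hj hh)
    fun _ => neg_two_mul_le_young ht _ _

theorem neg_two_integral_sum_weighted_mul_le (hγ : IsCutoff γ ρ cγ) (hi : i < s / 2)
    (hj : j < s / 2) (hF : ∀ l, ContDiff ℝ (⊤ : ℕ∞) (F l)) (hH : ∀ l, ContDiff ℝ (⊤ : ℕ∞) (H l))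
    (ht : 0 < t) :
    -2 * ∫ x, ∑ l, weighted γ ρ s i (F l) x * weighted γ ρ s j (H l) x ≤
      t * (∫ x, ∑ l, weighted γ ρ s i (F l) x ^ 2) +
        t⁻¹ * ∫ x, ∑ l, weighted γ ρ s j (H l) x ^ 2 := by
  refine neg_two_integral_le
    (integrable_finsetSum _ fun l _ => integrable_weighted_mul hγ hi (hF l).continuous
      (continuous_weighted hγ hj (hH l).continuous))
    (integrable_finsetSum _ fun l _ => integrable_sq_weighted hγ hi (hF l))
    (integrable_finsetSum _ fun l _ => integrable_sq_weighted hγ hj (hH l)) fun x => ?_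
  simp only [Finset.mul_sum, ← Finset.sum_add_distrib]
  exact Finset.sum_le_sum fun l _ => neg_two_mul_le_young ht _ _

theorem integrable_flux (hγ : IsCutoff γ ρ cγ) (hi : i < s / 2) (hj : j < s / 2)
    (hF : ∀ l, ContDiff ℝ (⊤ : ℕ∞) (F l)) (hh : ContDiff ℝ (⊤ : ℕ∞) h) :
    Integrable fun x => ∑ l, weighted γ ρ s i (F l) x *
      (weighted γ ρ s j h x * (ρ * pderiv1 l γ x)) :=
  integrable_finsetSum _ fun l _ => integrable_weighted_mul hγ hi (hF l).continuous
    ((continuous_weighted hγ hj hh.continuous).mul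
      (continuous_const.mul (contDiff_pderiv1 hγ.smooth l).continuous))

/-- Young's inequality for the flux term, with the small constant on the vector factor. -/
theorem neg_two_integral_flux_le (hγ : IsCutoff γ ρ cγ) (hρ : 0 < ρ) (hi : i < s / 2)
    (hj : j < s / 2) (hF : ∀ l, ContDiff ℝ (⊤ : ℕ∞) (F l)) (hh : ContDiff ℝ (⊤ : ℕ∞) h)
    (ht : 0 < t) :
    -2 * ∫ x, ∑ l, weighted γ ρ s i (F l) x * (weighted γ ρ s j h x * (ρ * pderiv1 l γ x)) ≤
      t * (∫ x, ∑ l, weighted γ ρ s i (F l) x ^ 2) +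
        t⁻¹ * (n * cγ ^ 2) * ∫ x, weighted γ ρ s j h x ^ 2 := by
  refine neg_two_integral_le (integrable_flux hγ hi hj hF hh)
    (integrable_finsetSum _ fun l _ => integrable_sq_weighted hγ hi (hF l))
    (integrable_sq_weighted hγ hj hh) fun x => ?_
  have h₁ := Finset.sum_le_sum fun l (_ : l ∈ Finset.univ) =>
    neg_two_mul_le_young ht (weighted γ ρ s i (F l) x)
      (weighted γ ρ s j h x * (ρ * pderiv1 l γ x))
  simp only [mul_pow (weighted γ ρ s j h x), Finset.sum_add_distrib, ← Finset.mul_sum] at h₁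
  have h₂ := mul_le_mul_of_nonneg_left (hγ.sum_sq_pderiv1_le hρ x)
    (mul_nonneg (inv_pos.2 ht).le (sq_nonneg (weighted γ ρ s j h x)))
  linarith

/-- Young's inequality for the flux term, with the small constant on the scalar factor. -/
theorem neg_two_integral_flux_le' (hγ : IsCutoff γ ρ cγ) (hρ : 0 < ρ) (hi : i < s / 2)
    (hj : j < s / 2) (hF : ∀ l, ContDiff ℝ (⊤ : ℕ∞) (F l)) (hh : ContDiff ℝ (⊤ : ℕ∞) h)
    (ht : 0 < t) :
    -2 * ∫ x, ∑ l, weighted γ ρ s i (F l) x * (weighted γ ρ s j h x * (ρ * pderiv1 l γ x)) ≤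
      t * (∫ x, weighted γ ρ s j h x ^ 2) +
        t⁻¹ * (n * cγ ^ 2) * ∫ x, ∑ l, weighted γ ρ s i (F l) x ^ 2 := by
  refine neg_two_integral_le (integrable_flux hγ hi hj hF hh) (integrable_sq_weighted hγ hj hh)
    (integrable_finsetSum _ fun l _ => integrable_sq_weighted hγ hi (hF l)) fun x => ?_
  have e : ∑ l, weighted γ ρ s i (F l) x * (weighted γ ρ s j h x * (ρ * pderiv1 l γ x)) =
      weighted γ ρ s j h x * ∑ l, weighted γ ρ s i (F l) x * (ρ * pderiv1 l γ x) := by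
    rw [Finset.mul_sum]
    exact Finset.sum_congr rfl fun l _ => by ring
  have cs := Finset.sum_mul_sq_le_sq_mul_sq Finset.univ
    (fun l => weighted γ ρ s i (F l) x) fun l => ρ * pderiv1 l γ x
  have h₁ := neg_two_mul_le_young ht (weighted γ ρ s j h x)
    (∑ l, weighted γ ρ s i (F l) x * (ρ * pderiv1 l γ x))
  have h₂ := cs.trans (mul_le_mul_of_nonneg_left (hγ.sum_sq_pderiv1_le hρ x)
    (Finset.sum_nonneg fun l _ => sq_nonneg (weighted γ ρ s i (F l) x)))
  have h₃ := mul_le_mul_of_nonneg_left h₂ (inv_pos.2 ht).le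
  rw [e]
  linarith

end young

/-- The absorption step: a quantity `Y` split into two cross terms, the second of which is
partially absorbed by `Y` itself. -/
theorem absorb_cross_term {Y Z P Q q M B : ℝ} (hq : 0 < q)
    (hY : Y = -P - q * Q) (hQ : ∀ t, 0 < t → -2 * Q ≤ t * Y + t⁻¹ * M * Z)
    (hP : -2 * P ≤ B) : Y ≤ B + q ^ 2 * M * Z := by
  have h := mul_le_mul_of_nonneg_left (hQ q⁻¹ (inv_pos.2 hq)) hq.le
  have e : q * (q⁻¹ * Y + q⁻¹⁻¹ * M * Z) = Y + q ^ 2 * M * Z := by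
    field_simp
  rw [e] at h
  linarith

/-- Closing a chain of interpolation inequalities between five consecutive orders. -/
theorem exists_interpolation_const {ε s M : ℝ} (hε : 0 < ε) (hs : 0 < s) (hM : 0 ≤ M)
    (k₁ k₂ k₃ : ℝ) (hk₁ : 0 ≤ k₁) (hk₂ : 0 ≤ k₂) :
    ∃ K : ℝ, ∀ A B C D E X : ℝ, 0 ≤ A →
      (∀ t, 0 < t → -2 * X ≤ t * A + t⁻¹ * M * B) →
      (∀ t, 0 < t → B ≤ t * A + t⁻¹ * C + k₁ * C) →
      (∀ t, 0 < t → C ≤ t * B + t⁻¹ * D + k₂ * D) →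
      (∀ t, 0 < t → D ≤ t * C + t⁻¹ * E + k₃ * E) →
      -2 * (s * X) ≤ ε * A + K * E := by
  obtain ⟨κ, hκ⟩ : ∃ κ, κ = s * ((ε / (2 * s))⁻¹ * M) := ⟨_, rfl⟩
  have hκ0 : 0 ≤ κ := by rw [hκ]; positivity
  obtain ⟨t₁, ht₁⟩ : ∃ t, t = ε / (4 * (κ + 1)) := ⟨_, rfl⟩
  have ht₁0 : 0 < t₁ := by rw [ht₁]; positivity
  obtain ⟨l₁, hl₁⟩ : ∃ l, l = t₁⁻¹ + k₁ := ⟨_, rfl⟩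
  have hl₁0 : 0 < l₁ := by rw [hl₁]; positivity
  obtain ⟨l₂, hl₂⟩ : ∃ l, l = (1 / (4 * l₁))⁻¹ + k₂ := ⟨_, rfl⟩
  have hl₂0 : 0 < l₂ := by rw [hl₂]; positivity
  obtain ⟨l₃, hl₃⟩ : ∃ l, l = (1 / (2 * l₂))⁻¹ + k₃ := ⟨_, rfl⟩
  refine ⟨4 * κ * l₁ * l₂ * l₃, fun A B C D E X hA hX hB hC hD => ?_⟩
  have hX' := mul_le_mul_of_nonneg_left (hX (ε / (2 * s)) (by positivity)) hs.le
  have hB' : B ≤ t₁ * A + l₁ * C := by rw [hl₁]; linarith [hB t₁ ht₁0]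
  have hC' : C ≤ 1 / (4 * l₁) * B + l₂ * D := by
    rw [hl₂]; linarith [hC (1 / (4 * l₁)) (by positivity)]
  have hD' : D ≤ 1 / (2 * l₂) * C + l₃ * E := by
    rw [hl₃]; linarith [hD (1 / (2 * l₂)) (by positivity)]
  have hDC : l₂ * D ≤ C / 2 + l₂ * l₃ * E := by
    have h := mul_le_mul_of_nonneg_left hD' hl₂0.le
    have e : l₂ * (1 / (2 * l₂) * C + l₃ * E) = C / 2 + l₂ * l₃ * E := by field_simp
    linarith
  have hCB : l₁ * C ≤ B / 2 + 2 * l₁ * l₂ * l₃ * E := by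
    have h := mul_le_mul_of_nonneg_left
      (show C ≤ 2 * (1 / (4 * l₁) * B) + 2 * (l₂ * l₃ * E) by linarith) hl₁0.le
    have e : l₁ * (2 * (1 / (4 * l₁) * B) + 2 * (l₂ * l₃ * E)) =
        B / 2 + 2 * l₁ * l₂ * l₃ * E := by field_simp; ring
    linarith
  have hBA : κ * B ≤ κ * (2 * t₁ * A + 4 * l₁ * l₂ * l₃ * E) :=
    mul_le_mul_of_nonneg_left (by linarith) hκ0
  have hκt : κ * t₁ * A ≤ ε / 4 * A := by
    refine mul_le_mul_of_nonneg_right ?_ hA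
    rw [ht₁, mul_div_assoc', div_le_div_iff₀ (by positivity) (by norm_num)]
    nlinarith
  have e : s * (ε / (2 * s) * A + (ε / (2 * s))⁻¹ * M * B) = ε / 2 * A + κ * B := by
    rw [hκ]; field_simp
  rw [e] at hX'
  linarith

/-- **Lemma 3.2.** For `u ∈ C^∞(ℝⁿ)`, `k ≥ 1`, `η = γˢ` with `s > 8` and `γ` a cutoff as
in `(γ)`, and for any `ε > 0`, there is `c₁ = c₁(ε,s,n) < ∞` with
`-2∫(Δ^{k+1}u)(∇ᵢΔᵏu)(∇ᵢη) ≤ ε∫|Δ^{k+1}u|²η + (c₁/ρ⁸)∫|Δ^{k-1}u|²γ^{s-8}`. -/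
theorem energy_cross_term_estimate_one (n : ℕ) (ε s cγ : ℝ)
    (hε : 0 < ε) (hs : 8 < s) (hcγ : 1 ≤ cγ) :
    ∃ c₁ : ℝ, ∀ (u γ : EuclideanSpace ℝ (Fin n) → ℝ), ContDiff ℝ (⊤ : ℕ∞) u →
      ∀ ρ : ℝ, 0 < ρ → IsCutoff γ ρ cγ → ∀ k : ℕ, 1 ≤ k →
      (-2) * (∫ x, ∑ i : Fin n, iterLap (k + 1) u x
            * pderiv1 i (iterLap k u) x * pderiv1 i (fun y => γ y ^ s) x)
        ≤ ε * (∫ x, (iterLap (k + 1) u x) ^ 2 * γ x ^ s)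
          + c₁ / ρ ^ 8 * (∫ x, (iterLap (k - 1) u x) ^ 2 * γ x ^ (s - 8)) := by
  obtain ⟨K, hK⟩ := exists_interpolation_const (s := s) (M := n * cγ ^ 2) hε (by linarith)
    (by positivity) ((s - 2) ^ 2 * (n * cγ ^ 2)) ((s - 4) ^ 2 * (n * cγ ^ 2))
    ((s - 6) ^ 2 * (n * cγ ^ 2)) (by positivity) (by positivity)
  refine ⟨K, fun u γ hu ρ hρ hγ k hk => ?_⟩
  obtain ⟨k, rfl⟩ := Nat.exists_eq_add_of_le' hk
  rw [Nat.add_sub_cancel, iterLap_succ, iterLap_succ]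
  generalize hv : iterLap k u = v
  replace hv : ContDiff ℝ (⊤ : ℕ∞) v := hv ▸ contDiff_iterLap hu k
  have hw := contDiff_Lap hv
  have hz := contDiff_Lap hw
  have h0 : ((0 : ℕ) : ℝ) < s / 2 := by push_cast; linarith
  have h1 : ((1 : ℕ) : ℝ) < s / 2 := by push_cast; linarith
  have h2 : ((2 : ℕ) : ℝ) < s / 2 := by push_cast; linarith
  have h3 : ((3 : ℕ) : ℝ) < s / 2 := by push_cast; linarith
  have h4 : ((4 : ℕ) : ℝ) < s / 2 := by push_cast; linarith
  have hA := integral_sq_weighted (f := Lap (Lap v)) hγ h0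
  have hE := integral_sq_weighted (f := v) hγ h4
  have hX := integral_mul_pderiv1_mul_pderiv1_rpow hγ hρ (by linarith : 2 < s)
    (Lap (Lap v)) (Lap v)
  have id₁ := integral_weighted_Lap_mul (i := 0) (j := 1) (s := s) hγ hρ h1 h2
    (by push_cast; linarith) hw hw
  have id₂ := integral_weighted_Lap_mul (i := 2) (j := 1) (s := s) hγ hρ h3 h2
    (by push_cast; linarith) hv hw
  have id₃ := integral_weighted_Lap_mul (i := 2) (j := 3) (s := s) hγ hρ h3 h4
    (by push_cast; linarith) hv hv
  have key := hK (∫ x, weighted γ ρ s 0 (Lap (Lap v)) x ^ 2)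
    (∫ x, ∑ l, weighted γ ρ s 1 (pderiv1 l (Lap v)) x ^ 2)
    (∫ x, weighted γ ρ s 2 (Lap v) x ^ 2)
    (∫ x, ∑ l, weighted γ ρ s 3 (pderiv1 l v) x ^ 2)
    (∫ x, weighted γ ρ s 4 v x ^ 2)
    (∫ x, ∑ l, weighted γ ρ s 1 (pderiv1 l (Lap v)) x *
      (weighted γ ρ s 0 (Lap (Lap v)) x * (ρ * pderiv1 l γ x)))
    (integral_nonneg fun x => sq_nonneg _)
    (fun t ht => neg_two_integral_flux_le' hγ hρ h1 h0 (fun l => contDiff_pderiv1 hw l) hz ht)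
    (fun t ht => absorb_cross_term (q := s - 2) (by linarith)
      (by simp only [pow_two]; push_cast at id₁; linarith)
      (fun t ht => neg_two_integral_flux_le hγ hρ h1 h2 (fun l => contDiff_pderiv1 hw l) hw ht)
      (neg_two_integral_weighted_mul_le hγ h0 h2 hz hw ht))
    (fun t ht => absorb_cross_term (q := s - 4)
      (P := ∫ x, ∑ l, weighted γ ρ s 3 (pderiv1 l v) x * weighted γ ρ s 1 (pderiv1 l (Lap v)) x)
      (by linarith)
      (by simp only [pow_two]; push_cast at id₂; linarith)
      (fun t ht => neg_two_integral_flux_le' hγ hρ h3 h2 (fun l => contDiff_pderiv1 hv l) hw ht)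
      (by
        have := neg_two_integral_sum_weighted_mul_le hγ h3 h1
          (fun l => contDiff_pderiv1 hv l) (fun l => contDiff_pderiv1 hw l) (inv_pos.2 ht)
        rw [inv_inv] at this
        linarith))
    (fun t ht => absorb_cross_term (q := s - 6) (by linarith)
      (by simp only [pow_two]; push_cast at id₃; linarith)
      (fun t ht => neg_two_integral_flux_le hγ hρ h3 h4 (fun l => contDiff_pderiv1 hv l) hv ht)
      (neg_two_integral_weighted_mul_le hγ h2 h4 hw hv ht))
  rw [hX]
  rw [hA, hE] at key
  norm_num at key ⊢
  calc _ ≤ _ := key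
    _ = _ := by ring
end
end

section
/- For every n ∈ ℕ and every k ∈ ℕ with k ≥ 1 there exists a function u ∈ C^∞(ℝⁿ × ℝ) such that ∂ₜu(x,t) = Δᵏu(x,t) for all (x,t) ∈ ℝⁿ × ℝ, u(x,t) = 0 for all x ∈ ℝⁿ and all t ≤ 0, and u is not identically zero (there exist x ∈ ℝⁿ and t > 0 with u(x,t) ≠ 0). In particular, smooth solutions of the polyharmonic heat equation on ℝⁿ are not uniquely determined by their initial values. -/
open MeasureTheory Metric Set

noncomputable section

/-- The holomorphic extension `z ↦ exp (-1/z²)` of the flat function. -/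
def flatExp (z : ℂ) : ℂ := Complex.exp (-(z ^ 2)⁻¹)

/-- The `m`-th derivative of the smooth function equal to `exp (-1/t²)` for `t > 0` and to `0`
for `t ≤ 0`. -/
def flatDeriv (m : ℕ) (t : ℝ) : ℝ :=
  if 0 < t then (iteratedDeriv m flatExp (t : ℂ)).re else 0

theorem analyticAt_flatExp {z : ℂ} (hz : z ≠ 0) : AnalyticAt ℂ flatExp z := by
  unfold flatExp
  have : z ^ 2 ≠ 0 := pow_ne_zero 2 hz
  fun_prop (disch := assumption)

theorem inv_five_mul_sq_le_re_inv_sq {t : ℝ} (ht : 0 < t) {z : ℂ} (hz : ‖z - t‖ ≤ t / 4) :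
    (5 * t ^ 2)⁻¹ ≤ ((z ^ 2)⁻¹).re := by
  have hsq : (z.re - t) ^ 2 + z.im ^ 2 ≤ (t / 4) ^ 2 := by
    have h := pow_le_pow_left₀ (norm_nonneg _) hz 2
    rw [Complex.sq_norm, Complex.normSq_apply] at h
    simp only [Complex.sub_re, Complex.ofReal_re, Complex.sub_im, Complex.ofReal_im] at h
    nlinarith
  have h1 : |z.re - t| ≤ t / 4 := abs_le_of_sq_le_sq (by nlinarith [sq_nonneg z.im]) (by positivity)
  obtain ⟨h1l, h1r⟩ := abs_le.1 h1
  have him : z.im ^ 2 ≤ t ^ 2 / 16 := by nlinarith [sq_nonneg (z.re - t)]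
  have hre : (3 * t / 4) ^ 2 ≤ z.re ^ 2 := pow_le_pow_left₀ (by positivity) (by linarith) 2
  have hnorm : z.re ^ 2 + z.im ^ 2 ≤ 25 / 16 * t ^ 2 := by nlinarith
  have hre' : 0 < z.re := by linarith
  have key : ((z ^ 2)⁻¹).re = (z.re ^ 2 - z.im ^ 2) / (z.re ^ 2 + z.im ^ 2) ^ 2 := by
    rw [Complex.inv_re, map_pow, Complex.normSq_apply, pow_two z, Complex.mul_re]
    ring
  rw [key, inv_eq_one_div, div_le_div_iff₀ (by positivity) (by positivity)]
  have h3 : (z.re ^ 2 + z.im ^ 2) ^ 2 ≤ (25 / 16 * t ^ 2) ^ 2 :=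
    pow_le_pow_left₀ (by positivity) hnorm 2
  have h4 : t ^ 2 / 2 ≤ z.re ^ 2 - z.im ^ 2 := by nlinarith
  have h5 : t ^ 2 / 2 * (5 * t ^ 2) ≤ (z.re ^ 2 - z.im ^ 2) * (5 * t ^ 2) :=
    mul_le_mul_of_nonneg_right h4 (by positivity)
  nlinarith [sq_nonneg (t ^ 2)]

theorem norm_iteratedDeriv_flatExp_le (m : ℕ) {t : ℝ} (ht : 0 < t) :
    ‖iteratedDeriv m flatExp (t : ℂ)‖ ≤
      m.factorial * 4 ^ m * (t⁻¹ ^ m * Real.exp (-(5 * t ^ 2)⁻¹)) := by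
  have hclosed : ∀ z ∈ closedBall (t : ℂ) (t / 4), z ≠ 0 := by
    rintro z hz rfl
    rw [mem_closedBall, dist_eq_norm, zero_sub, norm_neg, Complex.norm_real, Real.norm_eq_abs,
      abs_of_pos ht] at hz
    linarith
  have hdiff : DiffContOnCl ℂ flatExp (ball (t : ℂ) (t / 4)) :=
    DifferentiableOn.diffContOnCl fun z hz =>
      (analyticAt_flatExp (hclosed z (closure_ball_subset_closedBall hz))).differentiableAt
        |>.differentiableWithinAt
  have hbound : ∀ z ∈ sphere (t : ℂ) (t / 4), ‖flatExp z‖ ≤ Real.exp (-(5 * t ^ 2)⁻¹) := by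
    intro z hz
    rw [mem_sphere, dist_eq_norm] at hz
    rw [flatExp, Complex.norm_exp, Complex.neg_re]
    exact Real.exp_le_exp.2 (neg_le_neg (inv_five_mul_sq_le_re_inv_sq ht hz.le))
  refine (Complex.norm_iteratedDeriv_le_of_forall_mem_sphere_norm_le m (by positivity) hdiff
    hbound).trans_eq ?_
  rw [div_pow, inv_pow]
  field_simp

theorem inv_pow_mul_exp_le (j : ℕ) {t : ℝ} (ht : 0 < t) :
    t⁻¹ ^ j * Real.exp (-(5 * t ^ 2)⁻¹) ≤ √(5 ^ j * j.factorial) := by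
  apply Real.le_sqrt_of_sq_le
  set s := (5 * t ^ 2)⁻¹ with hs
  have hs0 : 0 < s := by positivity
  have hts : t⁻¹ ^ 2 = 5 * s := by rw [hs]; field_simp
  have hpow : s ^ j ≤ j.factorial * Real.exp s := by
    have := Real.pow_div_factorial_le_exp s hs0.le j
    rwa [div_le_iff₀' (by positivity)] at this
  have hexp : Real.exp s * Real.exp (-s) = 1 := by rw [← Real.exp_add]; simp
  have hle1 : Real.exp (-s) ≤ 1 := Real.exp_le_one_iff.2 (by linarith)
  calc (t⁻¹ ^ j * Real.exp (-s)) ^ 2 = 5 ^ j * s ^ j * (Real.exp (-s) * Real.exp (-s)) := by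
        rw [mul_pow, ← pow_mul, mul_comm j, pow_mul, hts, mul_pow]; ring
    _ ≤ 5 ^ j * (j.factorial * Real.exp s) * (Real.exp (-s) * 1) := by gcongr
    _ = 5 ^ j * j.factorial * (Real.exp s * Real.exp (-s)) := by ring
    _ = 5 ^ j * j.factorial := by rw [hexp, mul_one]

/-- An upper bound for `|flatDeriv m|`, of Gevrey order `3/2`. -/
def flatBound (m : ℕ) : ℝ := m.factorial * 4 ^ m * √(5 ^ m * m.factorial)

theorem flatBound_nonneg (m : ℕ) : 0 ≤ flatBound m := by unfold flatBound; positivity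

theorem flatDeriv_of_nonpos (m : ℕ) {t : ℝ} (ht : t ≤ 0) : flatDeriv m t = 0 :=
  if_neg ht.not_gt

theorem abs_flatDeriv_le (m : ℕ) (t : ℝ) : |flatDeriv m t| ≤ flatBound m := by
  rcases le_or_gt t 0 with ht | ht
  · simpa [flatDeriv_of_nonpos m ht] using flatBound_nonneg m
  rw [flatDeriv, if_pos ht]
  refine (Complex.abs_re_le_norm _).trans ((norm_iteratedDeriv_flatExp_le m ht).trans ?_)
  exact mul_le_mul_of_nonneg_left (inv_pow_mul_exp_le m ht) (by positivity)

theorem abs_flatDeriv_le_mul_sq (m : ℕ) (t : ℝ) :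
    |flatDeriv m t| ≤ m.factorial * 4 ^ m * √(5 ^ (m + 2) * (m + 2).factorial) * t ^ 2 := by
  rcases le_or_gt t 0 with ht | ht
  · rw [flatDeriv_of_nonpos m ht, abs_zero]
    positivity
  rw [flatDeriv, if_pos ht]
  refine (Complex.abs_re_le_norm _).trans ((norm_iteratedDeriv_flatExp_le m ht).trans ?_)
  have h : t⁻¹ ^ m * Real.exp (-(5 * t ^ 2)⁻¹) =
      t⁻¹ ^ (m + 2) * Real.exp (-(5 * t ^ 2)⁻¹) * t ^ 2 := by
    rw [pow_add]; field_simp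
  rw [h, mul_assoc _ (√_)]
  have := inv_pow_mul_exp_le (m + 2) ht
  gcongr

theorem hasDerivAt_flatDeriv (m : ℕ) (t : ℝ) :
    HasDerivAt (flatDeriv m) (flatDeriv (m + 1) t) t := by
  rcases lt_trichotomy t 0 with ht | rfl | ht
  · rw [flatDeriv_of_nonpos _ ht.le]
    refine (hasDerivAt_const t (0 : ℝ)).congr_of_eventuallyEq ?_
    filter_upwards [Iio_mem_nhds ht] with s hs
    exact flatDeriv_of_nonpos m (le_of_lt hs)
  · rw [flatDeriv_of_nonpos _ le_rfl, hasDerivAt_iff_isLittleO]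
    simp only [flatDeriv_of_nonpos m le_rfl, sub_zero, smul_zero]
    refine Asymptotics.IsBigO.trans_isLittleO (g := fun s : ℝ => s ^ 2)
      (Asymptotics.IsBigO.of_bound
        (m.factorial * 4 ^ m * √(5 ^ (m + 2) * (m + 2).factorial)) (.of_forall fun s => ?_))
      (Asymptotics.isLittleO_pow_id one_lt_two)
    rw [Real.norm_eq_abs, Real.norm_eq_abs, abs_of_nonneg (sq_nonneg s)]
    exact abs_flatDeriv_le_mul_sq m s
  · have hne : (t : ℂ) ≠ 0 := by exact_mod_cast ht.ne'
    have han : AnalyticAt ℂ (iteratedDeriv m flatExp) t := by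
      rw [iteratedDeriv_eq_iterate]
      exact (analyticAt_flatExp hne).iterated_deriv m
    have h := han.differentiableAt.hasDerivAt.real_of_complex
    rw [← iteratedDeriv_succ] at h
    rw [flatDeriv, if_pos ht]
    refine h.congr_of_eventuallyEq ?_
    filter_upwards [Ioi_mem_nhds ht] with s hs
    exact if_pos hs

theorem flatDeriv_zero_pos {t : ℝ} (ht : 0 < t) : 0 < flatDeriv 0 t := by
  rw [flatDeriv, if_pos ht, iteratedDeriv_zero, flatExp,
    show -((t : ℂ) ^ 2)⁻¹ = ((-(t ^ 2)⁻¹ : ℝ) : ℂ) by push_cast; rfl, Complex.exp_ofReal_re]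
  exact Real.exp_pos _

theorem factorial_add_le_two_pow_mul (m a : ℕ) :
    (m + a).factorial ≤ 2 ^ (m + a) * (m.factorial * a.factorial) := by
  rw [← Nat.add_choose_mul_factorial_mul_factorial m a, mul_assoc]
  exact Nat.mul_le_mul_right _ (Nat.choose_le_two_pow _ _)

theorem flatBound_add_div_factorial_le (a m : ℕ) :
    flatBound (m + a) / (2 * m).factorial ≤
      (8 ^ a * a.factorial * √(10 ^ a * a.factorial)) * (8 ^ m * √(10 ^ m / m.factorial)) := by
  have hfac : ((m + a).factorial : ℝ) ≤ 2 ^ (m + a) * (m.factorial * a.factorial) := by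
    exact_mod_cast factorial_add_le_two_pow_mul m a
  have hsq : (m.factorial : ℝ) * m.factorial ≤ (2 * m).factorial := by
    rw [two_mul]
    exact_mod_cast Nat.le_of_dvd (Nat.factorial_pos _)
      (Nat.factorial_mul_factorial_dvd_factorial_add m m)
  have hm : (0 : ℝ) < m.factorial := by positivity
  have hsqrt : √(5 ^ (m + a) * (2 ^ (m + a) * (m.factorial * a.factorial))) =
      √(10 ^ a * a.factorial) * (√(10 ^ m / m.factorial) * m.factorial) := by
    have hm' : √((m.factorial : ℝ) ^ 2) = m.factorial := Real.sqrt_sq hm.le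
    nth_rewrite 3 [← hm']
    rw [← Real.sqrt_mul (by positivity), ← Real.sqrt_mul (by positivity)]
    congr 1
    rw [show (10 : ℝ) = 5 * 2 by norm_num, mul_pow, mul_pow, pow_add, pow_add]
    field_simp
  calc flatBound (m + a) / (2 * m).factorial
      ≤ (2 ^ (m + a) * (m.factorial * a.factorial)) * 4 ^ (m + a) *
        √(5 ^ (m + a) * (2 ^ (m + a) * (m.factorial * a.factorial))) /
          (m.factorial * m.factorial) := by
        unfold flatBound
        gcongr
    _ = _ := by
        rw [hsqrt, show (8 : ℝ) = 2 * 4 by norm_num, mul_pow, mul_pow, pow_add, pow_add]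
        field_simp

theorem summable_pow_mul_sqrt_div_factorial (R : ℝ) (hR : 0 ≤ R) :
    Summable fun m : ℕ => R ^ m * √(10 ^ m / m.factorial) := by
  refine Summable.of_nonneg_of_le (fun m => by positivity) (fun m => ?_)
    (summable_geometric_two.mul_left (√(Real.exp (40 * R ^ 2))))
  have h := Real.pow_div_factorial_le_exp (40 * R ^ 2) (by positivity) m
  have heq : R ^ m * √(10 ^ m / m.factorial) =
      √((40 * R ^ 2) ^ m / m.factorial) * (1 / 2) ^ m := by
    have h1 : √((R ^ m) ^ 2) = R ^ m := Real.sqrt_sq (by positivity)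
    have h2 : √(((1 / 2 : ℝ) ^ m) ^ 2) = (1 / 2) ^ m := Real.sqrt_sq (by positivity)
    rw [← h1, ← h2, ← Real.sqrt_mul (by positivity), ← Real.sqrt_mul (by positivity)]
    congr 1
    rw [show (40 : ℝ) * R ^ 2 = 10 * (R ^ 2) * 4 by ring, mul_pow, mul_pow,
      ← pow_mul, ← pow_mul, ← pow_mul, mul_comm m, pow_mul (1 / 2 : ℝ)]
    have h4 : (4 : ℝ) ^ m * ((1 / 2) ^ 2) ^ m = 1 := by rw [← mul_pow]; norm_num
    linear_combination (-(10 ^ m / m.factorial * R ^ (2 * m))) * h4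
  rw [heq]
  gcongr

theorem summable_flatBound (a : ℕ) {R : ℝ} (hR : 0 ≤ R) :
    Summable fun m => flatBound (m + a) * (R ^ m / (2 * m).factorial) := by
  refine Summable.of_nonneg_of_le
    (fun m => mul_nonneg (flatBound_nonneg _) (by positivity)) (fun m => ?_)
    ((summable_pow_mul_sqrt_div_factorial (8 * R) (by positivity)).mul_left
      (8 ^ a * a.factorial * √(10 ^ a * a.factorial)))
  calc flatBound (m + a) * (R ^ m / (2 * m).factorial)
      = flatBound (m + a) / (2 * m).factorial * R ^ m := by ring
    _ ≤ _ := mul_le_mul_of_nonneg_right (flatBound_add_div_factorial_le a m) (by positivity)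
    _ = _ := by rw [mul_pow]; ring

/-- The `b`-th derivative of `x ^ N / N!`. -/
def monoDeriv (N b : ℕ) (x : ℝ) : ℝ := N.descFactorial b * x ^ (N - b) / N.factorial

theorem hasDerivAt_monoDeriv (N b : ℕ) (x : ℝ) :
    HasDerivAt (monoDeriv N b) (monoDeriv N (b + 1) x) x := by
  have h := ((hasDerivAt_pow (N - b) x).const_mul (N.descFactorial b : ℝ)).div_const
    (N.factorial : ℝ)
  refine h.congr_deriv ?_
  rw [monoDeriv, Nat.descFactorial_succ, Nat.sub_sub]
  push_cast
  ring

theorem abs_monoDeriv_le {q : ℕ} (hq : 2 ≤ q) (m b : ℕ) {x X : ℝ} (hX : 1 ≤ X) (hx : |x| ≤ X) :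
    |monoDeriv (q * m) b x| ≤
      b.factorial * (((Real.exp 1 * X) ^ q) ^ m / (2 * m).factorial) := by
  set N := q * m with hN
  have hfac : ((2 * m).factorial : ℝ) ≤ N.factorial := by
    exact_mod_cast Nat.factorial_le (Nat.mul_le_mul_right m hq)
  have hdesc : (N.descFactorial b : ℝ) ≤ b.factorial * Real.exp 1 ^ N := by
    have h := Real.pow_div_factorial_le_exp (N : ℝ) (by positivity) b
    rw [div_le_iff₀' (by positivity), ← Real.exp_one_pow] at h
    exact (by exact_mod_cast Nat.descFactorial_le_pow N b : (N.descFactorial b : ℝ) ≤ N ^ b).trans h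
  have hpow : |x| ^ (N - b) ≤ X ^ N :=
    (pow_le_pow_left₀ (abs_nonneg x) hx _).trans (pow_le_pow_right₀ hX (Nat.sub_le _ _))
  rw [monoDeriv, abs_div, abs_mul, abs_pow, Nat.abs_cast, Nat.abs_cast]
  calc (N.descFactorial b : ℝ) * |x| ^ (N - b) / N.factorial
      ≤ b.factorial * Real.exp 1 ^ N * X ^ N / (2 * m).factorial := by gcongr
    _ = _ := by rw [← pow_mul, mul_pow]; ring

/-- The mixed derivative `∂ₜᵃ ∂ₓᵇ` of Tychonoff's series `∑ₘ g⁽ᵐ⁾(t) x^(qm) / (qm)!`, evaluated at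
`p = (x, t)`. -/
def tychonoffSeries (q a b : ℕ) (p : ℝ × ℝ) : ℝ :=
  ∑' m, flatDeriv (m + a) p.2 * monoDeriv (q * m) b p.1

/-- A summable majorant for the terms of `tychonoffSeries q a b` on `|x| ≤ X`. -/
def tychonoffMajorant (q a b : ℕ) (X : ℝ) (m : ℕ) : ℝ :=
  flatBound (m + a) * (b.factorial * (((Real.exp 1 * X) ^ q) ^ m / (2 * m).factorial))

theorem summable_tychonoffMajorant (q a b : ℕ) {X : ℝ} (hX : 1 ≤ X) :
    Summable (tychonoffMajorant q a b X) := by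
  refine ((summable_flatBound a (R := (Real.exp 1 * X) ^ q) (by positivity)).mul_left
    (b.factorial : ℝ)).congr fun m => ?_
  rw [tychonoffMajorant]
  ring

theorem norm_tychonoffSeries_term_le {q : ℕ} (hq : 2 ≤ q) (a b m : ℕ) {p : ℝ × ℝ} {X : ℝ}
    (hX : 1 ≤ X) (hp : |p.1| ≤ X) :
    ‖flatDeriv (m + a) p.2 * monoDeriv (q * m) b p.1‖ ≤ tychonoffMajorant q a b X m := by
  rw [norm_mul, Real.norm_eq_abs, Real.norm_eq_abs]
  exact mul_le_mul (abs_flatDeriv_le _ _) (abs_monoDeriv_le hq m b hX hp) (abs_nonneg _)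
    (flatBound_nonneg _)

theorem summable_tychonoffSeries {q : ℕ} (hq : 2 ≤ q) (a b : ℕ) (p : ℝ × ℝ) :
    Summable fun m => flatDeriv (m + a) p.2 * monoDeriv (q * m) b p.1 :=
  have hX : 1 ≤ |p.1| + 1 := by linarith [abs_nonneg p.1]
  Summable.of_norm_bounded (summable_tychonoffMajorant q a b hX) fun m =>
    norm_tychonoffSeries_term_le hq a b m hX (by linarith)

theorem hasFDerivAt_tychonoffSeries {q : ℕ} (hq : 2 ≤ q) (a b : ℕ) (p : ℝ × ℝ) :
    HasFDerivAt (tychonoffSeries q a b)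
      (tychonoffSeries q (a + 1) b p • ContinuousLinearMap.snd ℝ ℝ ℝ +
        tychonoffSeries q a (b + 1) p • ContinuousLinearMap.fst ℝ ℝ ℝ) p := by
  set X : ℝ := ‖p‖ + 1
  have hX : 1 ≤ X := by linarith [norm_nonneg p]
  have hpmem : p ∈ ball (0 : ℝ × ℝ) X := by
    rw [mem_ball_zero_iff]; linarith
  have hmem : ∀ y ∈ ball (0 : ℝ × ℝ) X, |y.1| ≤ X := fun y hy =>
    (norm_fst_le y).trans (mem_ball_zero_iff.1 hy).le
  have hterm : ∀ (m : ℕ) (y : ℝ × ℝ), y ∈ ball (0 : ℝ × ℝ) X →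
      HasFDerivAt (fun y : ℝ × ℝ => flatDeriv (m + a) y.2 * monoDeriv (q * m) b y.1)
        ((flatDeriv (m + (a + 1)) y.2 * monoDeriv (q * m) b y.1) • ContinuousLinearMap.snd ℝ ℝ ℝ +
          (flatDeriv (m + a) y.2 * monoDeriv (q * m) (b + 1) y.1) •
            ContinuousLinearMap.fst ℝ ℝ ℝ) y := by
    intro m y _
    have h := ((hasDerivAt_flatDeriv (m + a) y.2).comp_hasFDerivAt y
      (hasFDerivAt_snd (𝕜 := ℝ))).mul
      ((hasDerivAt_monoDeriv (q * m) b y.1).comp_hasFDerivAt y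
        (hasFDerivAt_fst (𝕜 := ℝ)))
    refine h.congr_fderiv ?_
    ext <;> simp [add_assoc, mul_comm]
  have h := hasFDerivAt_tsum_of_isPreconnected
    ((summable_tychonoffMajorant q (a + 1) b hX).add (summable_tychonoffMajorant q a (b + 1) hX))
    isOpen_ball (convex_ball (0 : ℝ × ℝ) X).isPreconnected hterm
    (fun m y hy => ?_) hpmem (summable_tychonoffSeries hq a b p) hpmem
  · refine h.congr_fderiv ?_
    have h1 := summable_tychonoffSeries hq (a + 1) b p
    have h2 := summable_tychonoffSeries hq a (b + 1) p
    rw [Summable.tsum_add (h1.smul_const _) (h2.smul_const _), h1.tsum_smul_const,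
      h2.tsum_smul_const]
    rfl
  · refine (norm_add_le _ _).trans (add_le_add ?_ ?_)
    · rw [norm_smul]
      refine (mul_le_of_le_one_right (norm_nonneg _) (ContinuousLinearMap.norm_snd_le ..)).trans ?_
      exact norm_tychonoffSeries_term_le hq (a + 1) b m hX (hmem y hy)
    · rw [norm_smul]
      refine (mul_le_of_le_one_right (norm_nonneg _) (ContinuousLinearMap.norm_fst_le ..)).trans ?_
      exact norm_tychonoffSeries_term_le hq a (b + 1) m hX (hmem y hy)

theorem contDiff_tychonoffSeries {q : ℕ} (hq : 2 ≤ q) (a b : ℕ) :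
    ContDiff ℝ (⊤ : ℕ∞) (tychonoffSeries q a b) := by
  refine contDiff_infty.2 fun n => ?_
  induction n generalizing a b with
  | zero =>
    exact contDiff_zero.2 <| continuous_iff_continuousAt.2 fun p =>
      (hasFDerivAt_tychonoffSeries hq a b p).continuousAt
  | succ n ih =>
    refine contDiff_succ_iff_hasFDerivAt.2 ⟨_, ?_, hasFDerivAt_tychonoffSeries hq a b⟩
    exact ((ih (a + 1) b).smul contDiff_const).add ((ih a (b + 1)).smul contDiff_const)

theorem hasDerivAt_tychonoffSeries_time {q : ℕ} (hq : 2 ≤ q) (a b : ℕ) (x t : ℝ) :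
    HasDerivAt (fun τ => tychonoffSeries q a b (x, τ)) (tychonoffSeries q (a + 1) b (x, t)) t := by
  have h := (hasFDerivAt_tychonoffSeries hq a b (x, t)).comp_hasDerivAt t
    ((hasDerivAt_const t x).prodMk (hasDerivAt_id t))
  simpa [Function.comp_def] using h

theorem hasDerivAt_tychonoffSeries_space {q : ℕ} (hq : 2 ≤ q) (a b : ℕ) (x t : ℝ) :
    HasDerivAt (fun y => tychonoffSeries q a b (y, t)) (tychonoffSeries q a (b + 1) (x, t)) x := by
  have h := (hasFDerivAt_tychonoffSeries hq a b (x, t)).comp_hasDerivAt x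
    ((hasDerivAt_id x).prodMk (hasDerivAt_const x t))
  simpa [Function.comp_def] using h

/-- Tychonoff's series solves `∂ₜ = ∂ₓ^q`. -/
theorem tychonoffSeries_space_eq_time {q : ℕ} (hq : 2 ≤ q) (p : ℝ × ℝ) :
    tychonoffSeries q 0 q p = tychonoffSeries q 1 0 p := by
  rw [tychonoffSeries, (summable_tychonoffSeries hq 0 q p).tsum_eq_zero_add]
  have h0 : monoDeriv (q * 0) q p.1 = 0 := by
    rw [monoDeriv, Nat.descFactorial_of_lt (by omega)]
    simp
  rw [h0, mul_zero, zero_add]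
  refine tsum_congr fun m => ?_
  congr 1
  have hdesc : (q * m).factorial * (q * (m + 1)).descFactorial q = (q * (m + 1)).factorial := by
    rw [← Nat.factorial_mul_descFactorial (Nat.le_mul_of_pos_right q m.succ_pos), mul_add, mul_one,
      Nat.add_sub_cancel]
  rw [monoDeriv, monoDeriv, ← hdesc, mul_add, mul_one, Nat.add_sub_cancel]
  have : ((q * m + q).descFactorial q : ℝ) ≠ 0 := by
    exact_mod_cast (Nat.pos_of_ne_zero fun h => by
      rw [Nat.descFactorial_eq_zero_iff_lt] at h; omega).ne'
  push_cast
  rw [Nat.descFactorial_zero, Nat.sub_zero]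
  field_simp
  simp

theorem tychonoffSeries_of_nonpos (q a b : ℕ) (x : ℝ) {t : ℝ} (ht : t ≤ 0) :
    tychonoffSeries q a b (x, t) = 0 := by
  simp [tychonoffSeries, flatDeriv_of_nonpos _ ht]

theorem tychonoffSeries_zero_space {q : ℕ} (hq : 2 ≤ q) (t : ℝ) :
    tychonoffSeries q 0 0 (0, t) = flatDeriv 0 t := by
  rw [tychonoffSeries, tsum_eq_single 0]
  · simp [monoDeriv]
  · intro m hm
    have : q * m ≠ 0 := Nat.mul_ne_zero (by omega) hm
    simp [monoDeriv, this]

/-- The Laplacian of a function of one coordinate is its second derivative. -/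
theorem Lap_comp_coord {n : ℕ} (i : Fin n) {h h' h'' : ℝ → ℝ}
    (hh : ∀ s, HasDerivAt h (h' s) s) (hh' : ∀ s, HasDerivAt h' (h'' s) s) :
    Lap (fun y : EuclideanSpace ℝ (Fin n) => h (y i)) = fun y => h'' (y i) := by
  have hcomp : ∀ {f f' : ℝ → ℝ}, (∀ s, HasDerivAt f (f' s) s) →
      ∀ y : EuclideanSpace ℝ (Fin n), HasFDerivAt (fun y : EuclideanSpace ℝ (Fin n) => f (y i))
        (f' (y i) • (EuclideanSpace.proj i : EuclideanSpace ℝ (Fin n) →L[ℝ] ℝ)) y :=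
    fun hf y => (hf (y i)).comp_hasFDerivAt y
      (EuclideanSpace.proj i : EuclideanSpace ℝ (Fin n) →L[ℝ] ℝ).hasFDerivAt
  have hfderiv : fderiv ℝ (fun y : EuclideanSpace ℝ (Fin n) => h (y i)) =
      fun y => h' (y i) • (EuclideanSpace.proj i : EuclideanSpace ℝ (Fin n) →L[ℝ] ℝ) :=
    funext fun y => (hcomp hh y).fderiv
  funext x
  simp only [Lap, iteratedFDeriv_two_apply]
  have hsecond := ((hcomp hh' x).smul_const
    (EuclideanSpace.proj i : EuclideanSpace ℝ (Fin n) →L[ℝ] ℝ)).fderiv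
  rw [hfderiv, hsecond, Finset.sum_eq_single i]
  · simp
  · intro j _ hj
    simp [hj.symm]
  · simp

theorem iterLap_tychonoffSeries {n q : ℕ} (hq : 2 ≤ q) (i : Fin n) (t : ℝ) (j : ℕ) :
    iterLap j (fun y : EuclideanSpace ℝ (Fin n) => tychonoffSeries q 0 0 (y i, t)) =
      fun y => tychonoffSeries q 0 (2 * j) (y i, t) := by
  induction j with
  | zero => rfl
  | succ j ih =>
    rw [iterLap, Function.iterate_succ_apply', ← iterLap, ih]
    exact Lap_comp_coord i (h := fun s => tychonoffSeries q 0 (2 * j) (s, t))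
      (h' := fun s => tychonoffSeries q 0 (2 * j + 1) (s, t))
      (h'' := fun s => tychonoffSeries q 0 (2 * j + 2) (s, t))
      (fun s => hasDerivAt_tychonoffSeries_space hq 0 (2 * j) s t)
      (fun s => hasDerivAt_tychonoffSeries_space hq 0 (2 * j + 1) s t)

/-- **Tychonoff-type non-uniqueness for the polyharmonic heat equation.** For every
`n ≥ 1` and `k ≥ 1` there is a smooth function `u : ℝⁿ × ℝ → ℝ` with `∂ₜu = Δᵏu`
everywhere, `u(·,t) ≡ 0` for `t ≤ 0`, and `u` not identically zero. In particular smooth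
solutions of the polyharmonic heat equation are not determined by their initial values. -/
theorem tychonoff_nonuniqueness (n : ℕ) (hn : 0 < n) (k : ℕ) (hk : 1 ≤ k) :
    ∃ u : EuclideanSpace ℝ (Fin n) → ℝ → ℝ,
      ContDiff ℝ (⊤ : ℕ∞) (fun p : EuclideanSpace ℝ (Fin n) × ℝ => u p.1 p.2) ∧
      (∀ (x : EuclideanSpace ℝ (Fin n)) (t : ℝ),
        HasDerivAt (fun τ => u x τ) (iterLap k (fun y => u y t) x) t) ∧
      (∀ (x : EuclideanSpace ℝ (Fin n)) (t : ℝ), t ≤ 0 → u x t = 0) ∧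
      (∃ (x : EuclideanSpace ℝ (Fin n)) (t : ℝ), 0 < t ∧ u x t ≠ 0) := by
  have hq : 2 ≤ 2 * k := by omega
  let i : Fin n := ⟨0, hn⟩
  refine ⟨fun x t => tychonoffSeries (2 * k) 0 0 (x i, t), ?_, fun x t => ?_, fun x t ht => ?_,
    0, 1, one_pos, ?_⟩
  · have hi : ContDiff ℝ (⊤ : ℕ∞) fun p : EuclideanSpace ℝ (Fin n) × ℝ => (p.1 i, p.2) :=
      ((EuclideanSpace.proj i : EuclideanSpace ℝ (Fin n) →L[ℝ] ℝ).contDiff.comp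
        contDiff_fst).prodMk contDiff_snd
    exact (contDiff_tychonoffSeries hq 0 0).comp hi
  · rw [iterLap_tychonoffSeries hq]
    beta_reduce
    rw [tychonoffSeries_space_eq_time hq]
    exact hasDerivAt_tychonoffSeries_time hq 0 0 (x i) t
  · exact tychonoffSeries_of_nonpos _ _ _ _ ht
  · simpa [tychonoffSeries_zero_space hq] using (flatDeriv_zero_pos one_pos).ne'
end
end
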